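/- arXiv:1802.03754 — 7 statements merged into one kernel-verified Lean document; each statement's English description precedes it below -/
import Mathlib

section
/- Let G be a finite simple r-regular graph with r ≥ 1 and m(G) edges, and let b be an integer with (2r−1)(r+1) ≤ b ≤ 2m(G). Then there exists a matching M of G such that Σ_{u∈V(G)} τ_M(u) ≤ b and vacc(G, 0, d_G, b) ≤ 2·dyn(G, τ_M). -/
open scoped BigOperators Classical

/-- `H` is closed under the infection rule of `(G,ρ)` relative to the vertex set `A`:
every vertex `u ∈ A` with at least `ρ u` neighbors in `H` belongs to `H`. -/
def Closed {V : Type*} [Fintype V] (G : SimpleGraph V) (ρ : V → ℤ) (A H : Set V) : Prop :=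
  ∀ u ∈ A, ρ u ≤ ((H ∩ G.neighborSet u).ncard : ℤ) → u ∈ H

/-- `D` is a dynamic monopoly of the subgraph of `G` induced by `A` with thresholds `ρ`:
`D ⊆ A` and the smallest closed set containing `D` is all of `A`. -/
def IsDynMonoOn {V : Type*} [Fintype V] (G : SimpleGraph V) (ρ : V → ℤ) (A D : Set V) : Prop :=
  D ⊆ A ∧ ∀ H : Set V, D ⊆ H → H ⊆ A → Closed G ρ A H → A ⊆ H

/-- the minimum cardinality of a dynamic monopoly of the subgraph of `G` induced by `A` -/
noncomputable def dynOn {V : Type*} [Fintype V] (G : SimpleGraph V) (ρ : V → ℤ) (A : Set V) : ℕ :=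
  sInf {n | ∃ D : Set V, IsDynMonoOn G ρ A D ∧ D.ncard = n}

/-- the minimum cardinality of a dynamic monopoly of `(G,ρ)` -/
noncomputable def dyn {V : Type*} [Fintype V] (G : SimpleGraph V) (ρ : V → ℤ) : ℕ :=
  dynOn G ρ Set.univ

/-- the maximum of `dyn (G, τ + ι)` over all increments `ι` with `0 ≤ ι ≤ ιmax`
pointwise and total sum `b` -/
noncomputable def vacc {V : Type*} [Fintype V] (G : SimpleGraph V) (τ ιmax : V → ℤ) (b : ℤ) : ℕ :=
  sSup {n | ∃ ι : V → ℤ, (∀ u, 0 ≤ ι u ∧ ι u ≤ ιmax u) ∧ (∑ u, ι u) = b ∧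
    n = dyn G (fun v => τ v + ι v)}

/-- `M` is a matching of `G`: a set of edges of `G` that are pairwise disjoint -/
def MatchingSet {V : Type*} (G : SimpleGraph V) (M : Set (Sym2 V)) : Prop :=
  M ⊆ G.edgeSet ∧ ∀ e ∈ M, ∀ f ∈ M, e ≠ f → ∀ v : V, v ∈ e → v ∉ f

/-- `tauM G M u = d_G(u)` if `u` is an endpoint of an edge of `M`, and `0` otherwise -/
noncomputable def tauM {V : Type*} [Fintype V] (G : SimpleGraph V) [DecidableRel G.Adj]
    (M : Set (Sym2 V)) (u : V) : ℤ :=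
  if ∃ e ∈ M, u ∈ e then (G.degree u : ℤ) else 0


/-- degree of `u` inside `A` -/
noncomputable def dA {V : Type*} (G : SimpleGraph V) (A : Finset V) (u : V) : ℕ :=
  (A.filter (fun w => G.Adj u w)).card

/-- probability weight -/
noncomputable def wt (k d : ℕ) : ℚ := min 1 ((k : ℚ) / ((d : ℚ) + 1))

theorem wt_id (k d : ℕ) :
    (d : ℚ) * wt k (d - 1) + (if k ≤ d then 0 else 1) = ((d : ℚ) + 1) * wt k d := by
  have h1 : (0 : ℚ) < (d : ℚ) + 1 := by positivity
  unfold wt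
  split_ifs with h
  · have hk : (k : ℚ) ≤ d := by exact_mod_cast h
    rcases Nat.eq_zero_or_pos d with rfl | hd
    · have : k = 0 := by omega
      subst this
      simp
    · have hd' : (0 : ℚ) < d := by exact_mod_cast hd
      have e : ((d - 1 : ℕ) : ℚ) + 1 = d := by
        have : d - 1 + 1 = d := by omega
        exact_mod_cast this
      rw [e, min_eq_right, min_eq_right]
      · field_simp
        ring
      · rw [div_le_one h1]; linarith
      · rw [div_le_one hd']; exact hk
  · have hk : (d : ℚ) + 1 ≤ k := by
      have : d + 1 ≤ k := by omega
      exact_mod_cast this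
    rw [min_eq_left, min_eq_left]
    · ring
    · rw [le_div_iff₀ h1]; linarith
    · have h2 : (0 : ℚ) < ((d - 1 : ℕ) : ℚ) + 1 := by positivity
      rw [le_div_iff₀ h2]
      have : ((d - 1 : ℕ) : ℚ) ≤ d := by exact_mod_cast Nat.sub_le _ _
      linarith

theorem dA_erase {V : Type*} (G : SimpleGraph V) (A : Finset V) (u v : V) (hv : v ∈ A) :
    dA G (A.erase v) u = if G.Adj u v then dA G A u - 1 else dA G A u := by
  unfold dA
  rw [Finset.filter_erase]
  split_ifs with h
  · rw [Finset.card_erase_of_mem]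
    simp [hv, h]
  · rw [Finset.erase_eq_of_notMem]
    simp [h]

theorem avg_id {V : Type*} (G : SimpleGraph V) (k : V → ℕ) (A : Finset V) :
    ∑ v ∈ A, ((∑ u ∈ A.erase v, wt (k u) (dA G (A.erase v) u)) +
      (if k v ≤ dA G A v then 0 else 1)) = ∑ v ∈ A, ∑ u ∈ A, wt (k u) (dA G A u) := by
  have swap : ∑ v ∈ A, ∑ u ∈ A.erase v, wt (k u) (dA G (A.erase v) u)
      = ∑ u ∈ A, ∑ v ∈ A.erase u, wt (k u) (dA G (A.erase v) u) := by
    apply Finset.sum_comm'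
    intro x y
    simp only [Finset.mem_erase]
    tauto
  rw [Finset.sum_add_distrib, swap, ← Finset.sum_add_distrib, Finset.sum_comm]
  apply Finset.sum_congr rfl
  intro u hu
  have e1 : ∑ v ∈ A.erase u, wt (k u) (dA G (A.erase v) u)
      = ∑ v ∈ A.erase u, (wt (k u) (dA G A u) +
        if G.Adj u v then wt (k u) (dA G A u - 1) - wt (k u) (dA G A u) else 0) := by
    apply Finset.sum_congr rfl
    intro v hv
    rw [dA_erase G A u v (Finset.mem_of_mem_erase hv)]
    split_ifs <;> ring
  have e2 : (A.erase u).filter (fun v => G.Adj u v) = A.filter (fun v => G.Adj u v) := by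
    ext v
    simp only [Finset.mem_filter, Finset.mem_erase]
    constructor
    · tauto
    · rintro ⟨h1, h2⟩
      exact ⟨⟨h2.ne', h1⟩, h2⟩
  have e3 := wt_id (k u) (dA G A u)
  have e4 : ((A.erase u).card : ℚ) + 1 = A.card := by
    exact_mod_cast Finset.card_erase_add_one hu
  rw [e1, Finset.sum_add_distrib, ← Finset.sum_filter, e2]
  simp only [Finset.sum_const, nsmul_eq_mul]
  change _ + (dA G A u : ℚ) * _ + _ = _
  rw [← e4]
  linear_combination e3

theorem exists_D {V : Type*} (G : SimpleGraph V) (k : V → ℕ) (n : ℕ) :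
    ∀ A : Finset V, A.card = n → ∃ D : Finset V,
      (∀ H : Set V, ↑D ⊆ H → (∀ u ∈ A, k u ≤ dA G (A.filter (fun w => w ∈ H)) u → u ∈ H) →
        ↑A ⊆ H) ∧ (D.card : ℚ) ≤ ∑ u ∈ A, wt (k u) (dA G A u) := by
  induction n with
  | zero =>
    intro A hA
    have : A = ∅ := Finset.card_eq_zero.mp hA
    subst this
    exact ⟨∅, by simp, by simp⟩
  | succ n ih =>
    intro A hA
    have hne : A.Nonempty := by
      rw [← Finset.card_pos]; omega
    obtain ⟨v, hv, hle⟩ := Finset.exists_le_of_sum_le hne (avg_id G k A).le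
    obtain ⟨D, hD1, hD2⟩ := ih (A.erase v) (by rw [Finset.card_erase_of_mem hv]; omega)
    have key : ∀ H : Set V, ↑D ⊆ H →
        (∀ u ∈ A, k u ≤ dA G (A.filter (fun w => w ∈ H)) u → u ∈ H) →
        ∀ u ∈ A, u ≠ v → u ∈ H := by
      intro H hDH hcl u hu huv
      apply hD1 H hDH
      · intro x hx hk
        apply hcl x (Finset.mem_of_mem_erase hx) (hk.trans _)
        unfold dA
        apply Finset.card_le_card
        apply Finset.filter_subset_filter
        apply Finset.filter_subset_filter
        exact Finset.erase_subset _ _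
      · simp [hu, huv]
    by_cases hkv : k v ≤ dA G A v
    · rw [if_pos hkv] at hle
      refine ⟨D, ?_, by linarith⟩
      intro H hDH hcl u hu
      by_cases huv : u = v
      · subst huv
        apply hcl u hu (hkv.trans _)
        unfold dA
        apply Finset.card_le_card
        intro w hw
        simp only [Finset.mem_filter] at hw ⊢
        exact ⟨⟨hw.1, key H hDH hcl w hw.1 hw.2.ne'⟩, hw.2⟩
      · exact key H hDH hcl u hu huv
    · rw [if_neg hkv] at hle
      refine ⟨insert v D, ?_, ?_⟩
      · intro H hDH hcl u hu
        rw [Finset.coe_insert, Set.insert_subset_iff] at hDH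
        by_cases huv : u = v
        · subst huv; exact hDH.1
        · exact key H hDH.2 hcl u hu huv
      · have : ((insert v D).card : ℚ) ≤ D.card + 1 := by
          exact_mod_cast Finset.card_insert_le v D
        linarith

theorem dyn_le {V : Type*} [Fintype V] (G : SimpleGraph V) (ρ : V → ℤ) (D : Finset V)
    (h : IsDynMonoOn G ρ Set.univ ↑D) : dyn G ρ ≤ D.card := by
  unfold dyn dynOn
  apply Nat.sInf_le
  exact ⟨↑D, h, Set.ncard_coe_finset D⟩

theorem le_dyn {V : Type*} [Fintype V] (G : SimpleGraph V) (ρ : V → ℤ) (n : ℕ)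
    (h : ∀ D : Finset V, IsDynMonoOn G ρ Set.univ ↑D → n ≤ D.card) : n ≤ dyn G ρ := by
  unfold dyn dynOn
  apply le_csInf
  · exact ⟨_, Set.univ, ⟨subset_rfl, fun H hH _ _ => hH⟩, rfl⟩
  · rintro m ⟨D, hD, rfl⟩
    have := h D.toFinset (by simpa using hD)
    rwa [Set.ncard_eq_toFinset_card']

theorem ncard_nbr {V : Type*} [Fintype V] (G : SimpleGraph V) (H : Set V) (u : V) :
    (H ∩ G.neighborSet u).ncard = dA G (Finset.univ.filter (fun w => w ∈ H)) u := by
  unfold dA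
  rw [← Set.ncard_coe_finset]
  congr 1
  ext w
  simp

theorem dA_univ {V : Type*} [Fintype V] (G : SimpleGraph V) [DecidableRel G.Adj] (u : V) :
    dA G Finset.univ u = G.degree u := by
  unfold dA
  rw [← SimpleGraph.card_neighborFinset_eq_degree]
  congr 1
  ext w
  simp

theorem dyn_avg {V : Type*} [Fintype V] (G : SimpleGraph V) [DecidableRel G.Adj] (r : ℕ)
    (hreg : G.IsRegularOfDegree r) (ρ : V → ℤ) (h0 : ∀ u, 0 ≤ ρ u) :
    ((r : ℤ) + 1) * dyn G ρ ≤ ∑ u, ρ u := by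
  obtain ⟨D, hD1, hD2⟩ := exists_D G (fun u => (ρ u).toNat) _ Finset.univ rfl
  have hmono : IsDynMonoOn G ρ Set.univ ↑D := by
    refine ⟨Set.subset_univ _, ?_⟩
    intro H hDH _ hcl
    have := hD1 H hDH (by
      intro u _ hk
      apply hcl u (Set.mem_univ _)
      rw [ncard_nbr]
      exact Int.toNat_le.mp hk)
    simpa using this
  have h1 := dyn_le G ρ D hmono
  have h2 : ∑ u, wt ((ρ u).toNat) (dA G Finset.univ u) ≤ ∑ u, ((ρ u : ℤ) : ℚ) / ((r : ℚ) + 1) := by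
    apply Finset.sum_le_sum
    intro u _
    rw [dA_univ, hreg.degree_eq]
    unfold wt
    refine (min_le_right _ _).trans (le_of_eq ?_)
    congr 1
    exact_mod_cast Int.toNat_of_nonneg (h0 u)
  have hpos : (0 : ℚ) < (r : ℚ) + 1 := by positivity
  have h3 : (dyn G ρ : ℚ) ≤ (∑ u, ((ρ u : ℤ) : ℚ)) / ((r : ℚ) + 1) := by
    rw [Finset.sum_div]
    have : (dyn G ρ : ℚ) ≤ D.card := by exact_mod_cast h1
    exact this.trans (hD2.trans h2)
  rw [le_div_iff₀ hpos] at h3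
  have h4 : ((r : ℚ) + 1) * dyn G ρ ≤ ∑ u, ((ρ u : ℤ) : ℚ) := by linarith
  exact_mod_cast h4

theorem dyn_cover {V : Type*} [Fintype V] (G : SimpleGraph V) [DecidableRel G.Adj]
    (ρ : V → ℤ) (h0 : ∀ u, ρ u ≤ G.degree u) (D : Finset V)
    (hD : ∀ u v, G.Adj u v → u ∈ D ∨ v ∈ D) : dyn G ρ ≤ D.card := by
  apply dyn_le
  refine ⟨Set.subset_univ _, ?_⟩
  intro H hDH _ hcl u _
  by_cases hu : u ∈ D
  · exact hDH hu
  · apply hcl u (Set.mem_univ _)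
    rw [ncard_nbr]
    refine (h0 u).trans ?_
    rw [← dA_univ]
    unfold dA
    norm_cast
    apply Finset.card_le_card
    intro w hw
    simp only [Finset.mem_filter, Finset.mem_univ, true_and] at hw ⊢
    exact ⟨hDH ((hD u w hw).resolve_left hu), hw⟩

theorem matching_le_dyn {V : Type*} [Fintype V] (G : SimpleGraph V) [DecidableRel G.Adj]
    (M : Finset (Sym2 V)) (hM : MatchingSet G ↑M) : M.card ≤ dyn G (tauM G ↑M) := by
  apply le_dyn
  intro D hD
  have key : ∀ e ∈ M, ∃ v, v ∈ e ∧ v ∈ D := by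
    intro e he
    by_contra! hcon
    have hadj : e ∈ G.edgeSet := hM.1 he
    have hH := hD.2 {v | v ∉ e} (fun v hv hve => hcon v hve hv) (Set.subset_univ _) (by
      intro u _ hu hue
      have ht : tauM G ↑M u = G.degree u := if_pos ⟨e, he, hue⟩
      rw [ht, ncard_nbr, ← dA_univ] at hu
      obtain ⟨w, rfl⟩ := hue
      rw [SimpleGraph.mem_edgeSet] at hadj
      refine absurd (Int.ofNat_le.mp hu) (not_le.mpr ?_)
      · unfold dA
        apply Finset.card_lt_card
        rw [Finset.ssubset_iff_of_subset]
        · exact ⟨w, by simp [hadj], by simp⟩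
        · intro x hx
          simp only [Finset.mem_filter, Finset.mem_univ, true_and] at hx ⊢
          exact hx.2)
    induction e with
    | _ a c => exact hH (Set.mem_univ a) (Sym2.mem_mk_left a c)
  rcases M.eq_empty_or_nonempty with rfl | ⟨e0, he0⟩
  · simp
  have hV : Nonempty V := ⟨(key e0 he0).choose⟩
  choose! f hf using key
  apply Finset.card_le_card_of_injOn f (fun e he => (hf e he).2)
  intro e he e' he' heq
  by_contra hne
  apply hM.2 e he e' he' hne (f e) (hf e he).1
  rw [heq]
  exact (hf e' he').1

/-- covered vertices -/
noncomputable def cov {V : Type*} [Fintype V] (M : Finset (Sym2 V)) : Finset V :=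
  Finset.univ.filter (fun u => ∃ e ∈ M, u ∈ e)

theorem cov_card {V : Type*} [Fintype V] (M : Finset (Sym2 V)) : (cov M).card ≤ 2 * M.card := by
  have h : cov M = M.biUnion (fun e => Finset.univ.filter (fun u => u ∈ e)) := by
    ext u; simp [cov]
  rw [h, mul_comm]
  apply Finset.card_biUnion_le_card_mul
  intro e _
  induction e with
  | _ a c =>
    refine (Finset.card_le_card (t := {a, c}) ?_).trans Finset.card_le_two
    intro x; simp

theorem partial_immunization_regular {V : Type*} [Fintype V] [DecidableEq V]
    (G : SimpleGraph V) [DecidableRel G.Adj] (r : ℕ) (hr : 1 ≤ r)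
    (hreg : G.IsRegularOfDegree r) (b : ℤ)
    (hb1 : (2 * (r : ℤ) - 1) * ((r : ℤ) + 1) ≤ b)
    (hb2 : b ≤ 2 * (G.edgeFinset.card : ℤ)) :
    ∃ M : Set (Sym2 V), MatchingSet G M ∧
      (∑ u, tauM G M u) ≤ b ∧
      vacc G 0 (fun u => (G.degree u : ℤ)) b ≤ 2 * dyn G (tauM G M) := by
  have hr' : (1 : ℤ) ≤ r := by exact_mod_cast hr
  have hb0 : 0 ≤ b := by nlinarith
  let S : Finset (Finset (Sym2 V)) :=
    Finset.univ.filter (fun M => MatchingSet G (↑M : Set (Sym2 V)) ∧ 2 * (r : ℤ) * M.card ≤ b)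
  have hS : S.Nonempty := ⟨∅, by simp [S, MatchingSet, hb0]⟩
  obtain ⟨M, hMS, hmax⟩ := Finset.exists_max_image S Finset.card hS
  simp only [S, Finset.mem_filter, Finset.mem_univ, true_and] at hMS hmax
  obtain ⟨hM, hMb⟩ := hMS
  have hlow := matching_le_dyn G M hM
  have hcov := cov_card M
  refine ⟨↑M, hM, ?_, ?_⟩
  · have e : ∑ u, tauM G (↑M : Set (Sym2 V)) u = (cov M).card * (r : ℤ) := by
      unfold tauM cov
      simp only [hreg.degree_eq, Finset.mem_coe]
      rw [← Finset.sum_filter, Finset.sum_const, nsmul_eq_mul]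
      congr!
    rw [e]
    have : ((cov M).card : ℤ) ≤ 2 * M.card := by exact_mod_cast hcov
    nlinarith
  · suffices h : vacc G 0 (fun u => (G.degree u : ℤ)) b ≤ 2 * M.card by omega
    unfold vacc
    apply csSup_le'
    rintro n ⟨ι, hι, hsum, rfl⟩
    simp only [Pi.zero_apply, zero_add]
    by_cases hc : ∀ u v, G.Adj u v → u ∈ cov M ∨ v ∈ cov M
    · exact (dyn_cover G ι (fun u => (hι u).2) _ hc).trans hcov
    · push Not at hc
      obtain ⟨u, v, huv, hu, hv⟩ := hc
      simp only [cov, Finset.mem_filter, Finset.mem_univ, true_and, not_exists, not_and] at hu hv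
      have hnot : s(u, v) ∉ M := fun h => hu _ h (Sym2.mem_mk_left u v)
      have hlt : b < 2 * (r : ℤ) * (M.card + 1) := by
        by_contra! hcon
        have hc1 : (insert s(u, v) M).card = M.card + 1 := Finset.card_insert_of_notMem hnot
        have := hmax (insert s(u, v) M) ⟨?_, by rw [hc1]; push_cast; exact hcon⟩
        · omega
        · rw [Finset.coe_insert]
          constructor
          · rw [Set.insert_subset_iff]
            exact ⟨huv, hM.1⟩
          · have aux : ∀ f ∈ M, ∀ w, w ∈ s(u, v) → w ∉ f := by
              intro f hf w hw hwf
              rcases Sym2.mem_iff.mp hw with rfl | rfl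
              · exact hu f hf hwf
              · exact hv f hf hwf
            rintro e (rfl | he) f (rfl | hf) hne w hwe hwf
            · exact hne rfl
            · exact aux f hf w hwe hwf
            · exact aux e he w hwf hwe
            · exact hM.2 e he f hf hne w hwe hwf
      have havg := dyn_avg G r hreg ι (fun u => (hι u).1)
      rw [hsum] at havg
      by_contra! hcon
      have hcon' : 2 * (M.card : ℤ) + 1 ≤ dyn G ι := by exact_mod_cast hcon
      have h5 : ((r : ℤ) + 1) * (2 * (M.card : ℤ) + 1) ≤ b :=
        (mul_le_mul_of_nonneg_left hcon' (by linarith)).trans havg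
      nlinarith
end

section
/- Let T be a finite tree rooted at a vertex r, let τ, ι_max : V(T) → ℤ with ι_max(v) ≥ 0 for every vertex v, let u be a vertex of T with children v_1, …, v_k where k ≥ 1, and let b be an integer with 0 ≤ b ≤ Σ_{v∈V_u} ι_max(v). Suppose that for every i ∈ [k] and every integer b_i with 0 ≤ b_i ≤ Σ_{v∈V_{v_i}} ι_max(v) there exists a function ι : V_{v_i} → ℤ with 0 ≤ ι(v) ≤ ι_max(v) for every v ∈ V_{v_i} and Σ_{v∈V_{v_i}} ι(v) = b_i such that dyn(T_{v_i}, (τ+ι)|_{V_{v_i}}) = x_0(v_i,b_i) and dyn(T_{v_i}, ((τ+ι)^{→v_i})|_{V_{v_i}}) = x_1(v_i,b_i). Then for j ∈ {0,1}, x_j(u,b) equals z_j(u,b), where z_j(u,b) is the maximum of δ_j(b_u,b_1,…,b_k) + Σ_{i=1}^k x_1(v_i,b_i) over all tuples (b_u,b_1,…,b_k) of nonnegative integers with b_u + b_1 + ⋯ + b_k = b, b_u ≤ ι_max(u), and b_i ≤ Σ_{v∈V_{v_i}} ι_max(v) for every i ∈ [k], and where δ_j(b_u,b_1,…,b_k)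 = 0 if |{i ∈ [k] : x_0(v_i,b_i) = x_1(v_i,b_i)}| ≥ τ(u) + b_u − j, and δ_j(b_u,b_1,…,b_k) = 1 otherwise. -/
open scoped BigOperators Classical

/-- the set consisting of `u` and its descendants in the tree `T` rooted at `r`:
the vertices `v` such that every path from `r` to `v` passes through `u` -/
def descSet {V : Type*} (T : SimpleGraph V) (r u : V) : Set V :=
  {v | ∀ p : T.Walk r v, p.IsPath → u ∈ p.support}

/-- the sum `∑_{v ∈ s} f v` -/
noncomputable def setSum {V : Type*} [Fintype V] (s : Set V) (f : V → ℤ) : ℤ :=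
  ∑ v, s.indicator f v

/-- For `j ∈ {0,1}`, `xval T r τ ιmax j u b` is the maximum of
`dyn (T_u, ((τ+ι)^{→u applied j times})|_{V_u})` over all increments `ι` with
`0 ≤ ι ≤ ιmax` on `V_u` and `∑_{v ∈ V_u} ι v = b`. -/
noncomputable def xval {V : Type*} [Fintype V] [DecidableEq V] (T : SimpleGraph V) (r : V)
    (τ ιmax : V → ℤ) (j : ℤ) (u : V) (b : ℤ) : ℕ :=
  sSup {n | ∃ ι : V → ℤ, (∀ v ∈ descSet T r u, 0 ≤ ι v ∧ ι v ≤ ιmax v) ∧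
    setSum (descSet T r u) ι = b ∧
    n = dynOn T (fun v => τ v + ι v - if v = u then j else 0) (descSet T r u)}

/-- `zval T r τ ιmax j u v b` is the maximum of `δ_j(b_u,b_1,…,b_k) + ∑ᵢ x₁(vᵢ,bᵢ)`
over all tuples `(b_u,b_1,…,b_k)` of nonnegative integers summing to `b` with
`b_u ≤ ιmax u` and `bᵢ ≤ ∑_{w ∈ V_{vᵢ}} ιmax w` for every `i`, where
`δ_j = 0` if `|{i : x₀(vᵢ,bᵢ) = x₁(vᵢ,bᵢ)}| ≥ τ(u) + b_u − j` and `δ_j = 1` otherwise. -/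
noncomputable def zval {V : Type*} [Fintype V] [DecidableEq V] (T : SimpleGraph V) (r : V)
    (τ ιmax : V → ℤ) (j : ℤ) (u : V) {k : ℕ} (v : Fin k → V) (b : ℤ) : ℕ :=
  sSup {n | ∃ (bu : ℤ) (bs : Fin k → ℤ), 0 ≤ bu ∧ (∀ i, 0 ≤ bs i) ∧
    bu + ∑ i, bs i = b ∧ bu ≤ ιmax u ∧
    (∀ i, bs i ≤ setSum (descSet T r (v i)) ιmax) ∧
    n = (if τ u + bu - j ≤ ((Finset.univ.filter fun i : Fin k =>
          xval T r τ ιmax 0 (v i) (bs i) = xval T r τ ιmax 1 (v i) (bs i)).card : ℤ)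
        then 0 else 1) + ∑ i, xval T r τ ιmax 1 (v i) (bs i)}

section TreeFacts

variable {V : Type*} {T : SimpleGraph V} {r : V}

theorem mem_desc_iff (hT : T.IsTree) {w z : V} {p : T.Walk r w} (hp : p.IsPath) :
    w ∈ descSet T r z ↔ z ∈ p.support := by
  constructor
  · intro h
    exact h p hp
  · intro h q hq
    have : (⟨q, hq⟩ : T.Path r w) = ⟨p, hp⟩ := hT.isAcyclic.path_unique _ _
    have h2 : q = p := congrArg Subtype.val this
    rw [h2]
    exact h

theorem exists_rpath (hT : T.IsTree) (w : V) : ∃ p : T.Walk r w, p.IsPath := by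
  obtain ⟨q⟩ := hT.connected.preconnected r w
  exact ⟨q.toPath.1, q.toPath.2⟩

theorem desc_self (u : V) : u ∈ descSet T r u := fun p _ => p.end_mem_support

/-- transitivity -/
theorem desc_trans (hT : T.IsTree) {a b c : V} (hab : b ∈ descSet T r a)
    (hbc : c ∈ descSet T r b) : c ∈ descSet T r a := by
  obtain ⟨p, hp⟩ := exists_rpath (r := r) hT c
  rw [mem_desc_iff hT hp] at hbc ⊢
  have := (mem_desc_iff hT (hp.takeUntil hbc)).1 hab
  exact p.support_takeUntil_subset_support hbc this

theorem desc_antisymm (hT : T.IsTree) {a b : V} (hab : b ∈ descSet T r a)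
    (hba : a ∈ descSet T r b) : a = b := by
  by_contra hne
  obtain ⟨p, hp⟩ := exists_rpath (r := r) hT b
  have ha := (mem_desc_iff hT hp).1 hab
  have hb := (mem_desc_iff hT (hp.takeUntil ha)).1 hba
  have h1 := SimpleGraph.Walk.length_takeUntil_lt_length ha hne
  have h2 := (p.takeUntil a ha).length_takeUntil_le_length hb
  have h3 : (⟨(p.takeUntil a ha).takeUntil b hb, (hp.takeUntil ha).takeUntil hb⟩ : T.Path r b)
    = ⟨p, hp⟩ := hT.isAcyclic.path_unique _ _
  have h4 := congrArg Subtype.val h3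
  simp only at h4
  rw [h4] at h2
  omega

theorem desc_chain (hT : T.IsTree) {a b w : V} (ha : w ∈ descSet T r a)
    (hb : w ∈ descSet T r b) : b ∈ descSet T r a ∨ a ∈ descSet T r b := by
  obtain ⟨p, hp⟩ := exists_rpath (r := r) hT w
  have ha' := (mem_desc_iff hT hp).1 ha
  have hb' := (mem_desc_iff hT hp).1 hb
  have hspec := p.take_spec ha'
  rw [← hspec, SimpleGraph.Walk.mem_support_append_iff] at hb'
  rcases hb' with hb' | hb'
  · right
    exact (mem_desc_iff hT (hp.takeUntil ha')).2 hb'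
  · left
    have h2 := (p.dropUntil a ha').take_spec hb'
    have hp2 := hp
    rw [← hspec, ← h2, SimpleGraph.Walk.append_assoc] at hp2
    rw [mem_desc_iff hT hp2.of_append_left, SimpleGraph.Walk.mem_support_append_iff]
    left
    exact SimpleGraph.Walk.end_mem_support _

theorem desc_adj_aux (hT : T.IsTree) {x y : V} (h : T.Adj x y) (hxy : x ∉ descSet T r y) (z : V) :
    y ∈ descSet T r z ↔ x ∈ descSet T r z ∨ z = y := by
  obtain ⟨p, hp⟩ := exists_rpath (r := r) hT x
  rw [mem_desc_iff hT hp] at hxy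
  rw [mem_desc_iff hT (hp.concat hxy h), mem_desc_iff hT hp, SimpleGraph.Walk.support_concat]
  simp

theorem desc_adj (hT : T.IsTree) {x y : V} (h : T.Adj x y) :
    (x ∉ descSet T r y ∧ ∀ z, y ∈ descSet T r z ↔ x ∈ descSet T r z ∨ z = y) ∨
    (y ∉ descSet T r x ∧ ∀ z, x ∈ descSet T r z ↔ y ∈ descSet T r z ∨ z = x) := by
  by_cases h1 : x ∈ descSet T r y
  · right
    have h2 : y ∉ descSet T r x := fun h2 => h.ne (desc_antisymm hT h2 h1)
    exact ⟨h2, desc_adj_aux hT h.symm h2⟩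
  · exact Or.inl ⟨h1, desc_adj_aux hT h h1⟩

theorem child_facts (hT : T.IsTree) {u x : V} (h : T.Adj u x) (hx : x ∈ descSet T r u) :
    u ∉ descSet T r x ∧ ∀ z, x ∈ descSet T r z ↔ u ∈ descSet T r z ∨ z = x := by
  rcases desc_adj (r := r) hT h with h1 | h1
  · exact h1
  · exact absurd hx h1.1

theorem exists_child (hT : T.IsTree) {u w : V} (hw : w ∈ descSet T r u) (hne : w ≠ u) :
    ∃ x, T.Adj u x ∧ x ∈ descSet T r u ∧ w ∈ descSet T r x := by
  obtain ⟨p, hp⟩ := exists_rpath (r := r) hT w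
  have hu := (mem_desc_iff hT hp).1 hw
  have hspec := p.take_spec hu
  cases hq : p.dropUntil u hu with
  | nil => exact absurd rfl hne
  | @cons _ x _ h q =>
    rw [hq] at hspec
    refine ⟨x, h, ?_, ?_⟩
    · have hp2 := hp
      rw [← hspec, ← SimpleGraph.Walk.nil_append q, ← SimpleGraph.Walk.cons_append,
        SimpleGraph.Walk.append_assoc] at hp2
      rw [mem_desc_iff hT hp2.of_append_left, SimpleGraph.Walk.mem_support_append_iff]
      left
      exact SimpleGraph.Walk.end_mem_support _
    · rw [mem_desc_iff hT hp, ← hspec, SimpleGraph.Walk.mem_support_append_iff]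
      right
      simp

end TreeFacts

/-- abstract description of the rooted subtree at `u` with child subtrees `A i` -/
structure Split {V : Type*} (G : SimpleGraph V) (A : Set V) (u : V) {k : ℕ} (v : Fin k → V)
    (B : Fin k → Set V) : Prop where
  inj : Function.Injective v
  uA : u ∈ A
  sub : ∀ i, B i ⊆ A
  uB : ∀ i, u ∉ B i
  cover : ∀ w ∈ A, w = u ∨ ∃ i, w ∈ B i
  disj : ∀ i j w, w ∈ B i → w ∈ B j → i = j
  vB : ∀ i, v i ∈ B i
  adjv : ∀ i, G.Adj u (v i)
  adju : ∀ x ∈ A, G.Adj u x → ∃ i, x = v i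
  adjB : ∀ i, ∀ w ∈ B i, ∀ x ∈ A, G.Adj w x → x ∈ B i ∨ (x = u ∧ w = v i)

theorem split_desc {V : Type*} {T : SimpleGraph V} (hT : T.IsTree) (r : V)
    (u : V) (k : ℕ) (v : Fin k → V) (hinj : Function.Injective v)
    (hchild : ∀ w : V, (T.Adj u w ∧ w ∈ descSet T r u) ↔ ∃ i, v i = w) :
    Split T (descSet T r u) u v (fun i => descSet T r (v i)) := by
  have hc : ∀ i, T.Adj u (v i) ∧ v i ∈ descSet T r u := fun i => (hchild _).2 ⟨i, rfl⟩
  have hf := fun i => child_facts (r := r) hT (hc i).1 (hc i).2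
  refine ⟨hinj, desc_self u, fun i w hw => desc_trans hT (hc i).2 hw, fun i => (hf i).1,
    ?_, ?_, fun i => desc_self _, fun i => (hc i).1, ?_, ?_⟩
  · intro w hw
    by_cases hne : w = u
    · exact Or.inl hne
    · obtain ⟨x, h1, h2, h3⟩ := exists_child hT hw hne
      obtain ⟨i, rfl⟩ := (hchild x).1 ⟨h1, h2⟩
      exact Or.inr ⟨i, h3⟩
  · intro i j w hi hj
    apply hinj
    rcases desc_chain hT hi hj with h | h
    · rcases ((hf j).2 _).1 h with h | h
      · exact absurd h (hf i).1
      · exact h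
    · rcases ((hf i).2 _).1 h with h | h
      · exact absurd h (hf j).1
      · exact h.symm
  · intro x hx h
    obtain ⟨i, hi⟩ := (hchild x).1 ⟨h, hx⟩
    exact ⟨i, hi.symm⟩
  · intro i w hw x hx hadj
    rcases desc_adj (r := r) hT hadj with ⟨h1, h2⟩ | ⟨h1, h2⟩
    · exact Or.inl ((h2 _).2 (Or.inl hw))
    · rcases (h2 _).1 hw with h | h
      · exact Or.inl h
      · right
        subst h
        refine ⟨?_, rfl⟩
        have hux : u ∈ descSet T r x := by
          have := (h2 x).2 (Or.inl (desc_self x))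
          rcases ((hf i).2 _).1 this with h | h
          · exact h
          · exact absurd (h ▸ desc_self x) h1
        exact desc_antisymm hT hux hx

section Dyn

variable {V : Type*} [Fintype V] {G : SimpleGraph V}

theorem dyn_congr {ρ σ : V → ℤ} {A : Set V} (h : ∀ w ∈ A, ρ w = σ w) :
    dynOn G ρ A = dynOn G σ A := by
  have hC : ∀ H, Closed G ρ A H ↔ Closed G σ A H := by
    intro H
    unfold Closed
    refine forall₂_congr fun w hw => ?_
    rw [h w hw]
  unfold dynOn IsDynMonoOn
  simp only [hC]

theorem dyn_self (ρ : V → ℤ) (A : Set V) : IsDynMonoOn G ρ A A :=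
  ⟨subset_rfl, fun _ h _ _ => h⟩

theorem dyn_le_s5 {ρ : V → ℤ} {A D : Set V} (h : IsDynMonoOn G ρ A D) : dynOn G ρ A ≤ D.ncard :=
  Nat.sInf_le ⟨D, h, rfl⟩

theorem dyn_exists (ρ : V → ℤ) (A : Set V) : ∃ D, IsDynMonoOn G ρ A D ∧ D.ncard = dynOn G ρ A :=
  Nat.sInf_mem (s := {n | ∃ D : Set V, IsDynMonoOn G ρ A D ∧ D.ncard = n})
    ⟨_, A, dyn_self ρ A, rfl⟩

theorem dyn_le_card (ρ : V → ℤ) (A : Set V) : dynOn G ρ A ≤ Fintype.card V := by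
  refine (dyn_le_s5 (dyn_self ρ A)).trans ?_
  rw [← Nat.card_eq_fintype_card, ← Set.ncard_univ]
  exact Set.ncard_le_ncard (Set.subset_univ _)

theorem dynMono_mono {ρ σ : V → ℤ} {A D : Set V} (h : ∀ w, σ w ≤ ρ w)
    (hD : IsDynMonoOn G ρ A D) : IsDynMonoOn G σ A D :=
  ⟨hD.1, fun H h1 h2 h3 => hD.2 H h1 h2 fun w hw h4 => h3 w hw ((h w).trans h4)⟩

theorem dyn_mono {ρ σ : V → ℤ} {A : Set V} (h : ∀ w, σ w ≤ ρ w) :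
    dynOn G σ A ≤ dynOn G ρ A := by
  obtain ⟨D, hD, hc⟩ := dyn_exists (G := G) ρ A
  exact hc ▸ dyn_le_s5 (dynMono_mono h hD)

/-- the decreased threshold -/
noncomputable def dec (ρ : V → ℤ) (x : V) : V → ℤ := fun w => ρ w - if w = x then 1 else 0

theorem dec_le (ρ : V → ℤ) (x w : V) : dec ρ x w ≤ ρ w := by
  unfold dec; split_ifs <;> omega

variable {A : Set V} {u : V} {k : ℕ} {v : Fin k → V} {B : Fin k → Set V}

/-- restriction of a closed set to a child subtree -/
theorem Split.closed_inter (S : Split G A u v B) {ρ : V → ℤ} {H : Set V}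
    (hc : Closed G ρ A H) (i : Fin k) : Closed G ρ (B i) (H ∩ B i) := by
  intro w hw h
  refine ⟨hc w (S.sub i hw) (h.trans ?_), hw⟩
  exact_mod_cast Set.ncard_le_ncard (Set.inter_subset_inter_left _ Set.inter_subset_left)

theorem Split.closed_inter_dec (S : Split G A u v B) {ρ : V → ℤ} {H : Set V} (hu : u ∈ H)
    (hc : Closed G ρ A H) (i : Fin k) : Closed G (dec ρ (v i)) (B i) (H ∩ B i) := by
  intro w hw h
  refine ⟨hc w (S.sub i hw) ?_, hw⟩
  unfold dec at h
  split_ifs at h with hwv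
  · subst hwv
    have h1 : insert u ((H ∩ B i) ∩ G.neighborSet (v i)) ⊆ H ∩ G.neighborSet (v i) := by
      intro x hx
      rcases hx with rfl | hx
      · exact ⟨hu, (S.adjv i).symm⟩
      · exact ⟨hx.1.1, hx.2⟩
    have h2 := Set.ncard_le_ncard h1
    rw [Set.ncard_insert_of_notMem (fun hh => S.uB i hh.1.2)] at h2
    have : (((H ∩ B i) ∩ G.neighborSet (v i)).ncard : ℤ) + 1 ≤ (H ∩ G.neighborSet (v i)).ncard := by
      exact_mod_cast h2
    omega
  · rw [sub_zero] at h
    refine h.trans ?_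
    exact_mod_cast Set.ncard_le_ncard (Set.inter_subset_inter_left _ Set.inter_subset_left)

/-- restriction of a dynamic monopoly -/
theorem Split.restrict (S : Split G A u v B) {ρ : V → ℤ} {D : Set V}
    (hD : IsDynMonoOn G ρ A D) (i : Fin k) : IsDynMonoOn G (dec ρ (v i)) (B i) (D ∩ B i) := by
  refine ⟨Set.inter_subset_right, fun H h1 h2 h3 => ?_⟩
  have key := hD.2 (H ∪ (A \ B i)) ?_ ?_ ?_
  · intro w hw
    rcases key (S.sub i hw) with h | h
    · exact h
    · exact absurd hw h.2
  · intro w hw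
    by_cases hB : w ∈ B i
    · exact Or.inl (h1 ⟨hw, hB⟩)
    · exact Or.inr ⟨hD.1 hw, hB⟩
  · exact Set.union_subset (h2.trans (S.sub i)) Set.diff_subset
  · intro w hw h
    by_cases hB : w ∈ B i
    · left
      apply h3 w hB
      unfold dec
      split_ifs with hwv
      · have h4 : (H ∪ (A \ B i)) ∩ G.neighborSet w ⊆ insert u (H ∩ G.neighborSet w) := by
          rintro x ⟨hx | hx, hx2⟩
          · exact Or.inr ⟨hx, hx2⟩
          · rcases S.adjB i w hB x hx.1 hx2 with h | h
            · exact absurd h hx.2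
            · exact Or.inl h.1
        have h5 := (Set.ncard_le_ncard h4).trans (Set.ncard_insert_le _ _)
        have : (((H ∪ (A \ B i)) ∩ G.neighborSet w).ncard : ℤ) ≤ (H ∩ G.neighborSet w).ncard + 1 := by
          exact_mod_cast h5
        omega
      · have h4 : (H ∪ (A \ B i)) ∩ G.neighborSet w ⊆ H ∩ G.neighborSet w := by
          rintro x ⟨hx | hx, hx2⟩
          · exact ⟨hx, hx2⟩
          · rcases S.adjB i w hB x hx.1 hx2 with h | h
            · exact absurd h hx.2
            · exact absurd h.2 hwv
        rw [sub_zero]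
        refine h.trans ?_
        exact_mod_cast Set.ncard_le_ncard h4
    · exact Or.inr ⟨hw, hB⟩

theorem Split.sum_inter (S : Split G A u v B) {D : Set V} (hD : D ⊆ A) :
    D.ncard = (if u ∈ D then 1 else 0) + ∑ i, (D ∩ B i).ncard := by
  have h1 : D = (D ∩ {u}) ∪ ⋃ i, D ∩ B i := by
    ext w
    simp only [Set.mem_union, Set.mem_inter_iff, Set.mem_singleton_iff, Set.mem_iUnion]
    constructor
    · intro hw
      rcases S.cover w (hD hw) with h | ⟨i, h⟩
      · exact Or.inl ⟨hw, h⟩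
      · exact Or.inr ⟨i, hw, h⟩
    · rintro (h | ⟨i, h⟩) <;> exact h.1
  have h2 : (⋃ i, D ∩ B i).ncard = ∑ i, (D ∩ B i).ncard := by
    have : ∀ i, (D ∩ B i).Finite := fun i => Set.toFinite _
    have h3 := Set.ncard_iUnion_of_finite this (by
      intro i j hij
      rw [Function.onFun, Set.disjoint_left]
      intro w hw hw2
      exact hij (S.disj i j w hw.2 hw2.2))
    rw [h3, finsum_eq_sum_of_fintype]
  have h4 : Disjoint (D ∩ {u}) (⋃ i, D ∩ B i) := by
    rw [Set.disjoint_left]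
    rintro w ⟨_, rfl⟩ hw
    obtain ⟨i, hi⟩ := Set.mem_iUnion.1 hw
    exact S.uB i hi.2
  conv_lhs => rw [h1]
  rw [Set.ncard_union_eq h4, h2]
  congr 1
  split_ifs with hu
  · rw [Set.inter_eq_right.2 (by simpa using hu), Set.ncard_singleton]
  · rw [Set.inter_singleton_eq_empty.2 hu, Set.ncard_empty]

/-- gluing -/
theorem Split.glue (S : Split G A u v B) {ρ : V → ℤ} {D : Set V} (hD : D ⊆ A)
    (h : ∀ i, IsDynMonoOn G (dec ρ (v i)) (B i) (D ∩ B i))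
    (hu : ∀ H, D ⊆ H → H ⊆ A → Closed G ρ A H → u ∈ H) : IsDynMonoOn G ρ A D := by
  refine ⟨hD, fun H h1 h2 h3 w hw => ?_⟩
  have huH := hu H h1 h2 h3
  rcases S.cover w hw with rfl | ⟨i, hi⟩
  · exact huH
  · exact ((h i).2 (H ∩ B i) (Set.inter_subset_inter_left _ h1) Set.inter_subset_right
      (S.closed_inter_dec huH h3 i) hi).1

theorem Split.count (S : Split G A u v B) {H : Set V} (hH : H ⊆ A) :
    (H ∩ G.neighborSet u).ncard = (Finset.univ.filter fun i => v i ∈ H).card := by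
  have : H ∩ G.neighborSet u = ((Finset.univ.filter fun i => v i ∈ H).image v : Finset V) := by
    ext x
    simp only [Set.mem_inter_iff, SimpleGraph.mem_neighborSet, Finset.coe_image, Finset.coe_filter,
      Finset.mem_univ, true_and, Set.mem_image, Set.mem_setOf_eq]
    constructor
    · rintro ⟨h1, h2⟩
      obtain ⟨i, rfl⟩ := S.adju x (hH h1) h2
      exact ⟨i, h1, rfl⟩
    · rintro ⟨i, h1, rfl⟩
      exact ⟨h1, S.adjv i⟩
  rw [this, Set.ncard_coe_finset, Finset.card_image_of_injective _ S.inj]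

/-- minimal closed superset -/
theorem exists_hull (G : SimpleGraph V) (ρ : V → ℤ) {A D : Set V} (hD : D ⊆ A) :
    ∃ H, D ⊆ H ∧ H ⊆ A ∧ Closed G ρ A H ∧
      ∀ K, D ⊆ K → K ⊆ A → Closed G ρ A K → H ⊆ K := by
  refine ⟨{w | w ∈ A ∧ ∀ K, D ⊆ K → K ⊆ A → Closed G ρ A K → w ∈ K}, ?_, ?_, ?_, ?_⟩
  · intro w hw
    exact ⟨hD hw, fun K h _ _ => h hw⟩
  · intro w hw
    exact hw.1
  · intro w hw h
    refine ⟨hw, fun K h1 h2 h3 => h3 w hw (h.trans ?_)⟩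
    refine Int.ofNat_le.2 (Set.ncard_le_ncard (Set.inter_subset_inter_left _ ?_))
    intro x hx
    exact hx.2 K h1 h2 h3
  · intro K h1 h2 h3 w hw
    exact hw.2 K h1 h2 h3

theorem Split.dyn_eq (S : Split G A u v B) (ρ : V → ℤ) :
    dynOn G ρ A = (if ρ u ≤ ((Finset.univ.filter fun i : Fin k =>
        dynOn G ρ (B i) = dynOn G (dec ρ (v i)) (B i)).card : ℤ) then 0 else 1) +
      ∑ i, dynOn G (dec ρ (v i)) (B i) := by
  apply le_antisymm
  · choose D0 hD0 hc0 using fun i => dyn_exists (G := G) ρ (B i)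
    choose D1 hD1 hc1 using fun i => dyn_exists (G := G) (dec ρ (v i)) (B i)
    split_ifs with hδ
    · let E : Fin k → Set V := fun i =>
        if dynOn G ρ (B i) = dynOn G (dec ρ (v i)) (B i) then D0 i else D1 i
      have hE : ∀ i, IsDynMonoOn G (dec ρ (v i)) (B i) (E i) := by
        intro i
        dsimp only [E]
        split_ifs
        · exact dynMono_mono (dec_le ρ _) (hD0 i)
        · exact hD1 i
      have hEc : ∀ i, (E i).ncard = dynOn G (dec ρ (v i)) (B i) := by
        intro i
        dsimp only [E]
        split_ifs with h
        · rw [hc0, h]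
        · exact hc1 i
      have hint : ∀ i, (⋃ j, E j) ∩ B i = E i := by
        intro i
        ext w
        constructor
        · rintro ⟨h1, h2⟩
          obtain ⟨j, hj⟩ := Set.mem_iUnion.1 h1
          have := S.disj j i w ((hE j).1 hj) h2
          exact this ▸ hj
        · intro h
          exact ⟨Set.mem_iUnion.2 ⟨i, h⟩, (hE i).1 h⟩
      have hsub : (⋃ j, E j) ⊆ A := Set.iUnion_subset fun i => (hE i).1.trans (S.sub i)
      have huE : u ∉ ⋃ j, E j := by
        intro h
        obtain ⟨j, hj⟩ := Set.mem_iUnion.1 h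
        exact S.uB j ((hE j).1 hj)
      have hdm : IsDynMonoOn G ρ A (⋃ j, E j) := by
        refine S.glue hsub (fun i => by rw [hint]; exact hE i) ?_
        intro H h1 h2 h3
        apply h3 u S.uA
        rw [S.count h2]
        refine hδ.trans ?_
        refine Int.ofNat_le.2 (Finset.card_le_card ?_)
        intro i hi
        simp only [Finset.mem_filter, Finset.mem_univ, true_and] at hi ⊢
        have hEi : E i = D0 i := if_pos hi
        refine ((hD0 i).2 (H ∩ B i) ?_ Set.inter_subset_right (S.closed_inter h3 i) (S.vB i)).1
        intro w hw
        exact ⟨h1 (Set.mem_iUnion.2 ⟨i, hEi ▸ hw⟩), (hD0 i).1 hw⟩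
      have := dyn_le_s5 hdm
      rw [S.sum_inter hsub, if_neg huE] at this
      simpa only [hint, hEc] using this
    · have hint : ∀ i, (insert u (⋃ j, D1 j)) ∩ B i = D1 i := by
        intro i
        ext w
        constructor
        · rintro ⟨rfl | h1, h2⟩
          · exact absurd h2 (S.uB i)
          obtain ⟨j, hj⟩ := Set.mem_iUnion.1 h1
          have := S.disj j i w ((hD1 j).1 hj) h2
          exact this ▸ hj
        · intro h
          exact ⟨Or.inr (Set.mem_iUnion.2 ⟨i, h⟩), (hD1 i).1 h⟩
      have hsub : (insert u (⋃ j, D1 j)) ⊆ A :=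
        Set.insert_subset S.uA (Set.iUnion_subset fun i => (hD1 i).1.trans (S.sub i))
      have hdm : IsDynMonoOn G ρ A (insert u (⋃ j, D1 j)) :=
        S.glue hsub (fun i => by rw [hint]; exact hD1 i)
          (fun H h1 _ _ => h1 (Set.mem_insert _ _))
      have := dyn_le_s5 hdm
      rw [S.sum_inter hsub, if_pos (Set.mem_insert _ _)] at this
      simpa only [hint, hc1] using this
  · obtain ⟨D, hD, hDc⟩ := dyn_exists (G := G) ρ A
    rw [← hDc, S.sum_inter hD.1]
    have hle : ∀ i, dynOn G (dec ρ (v i)) (B i) ≤ (D ∩ B i).ncard := fun i =>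
      dyn_le_s5 (S.restrict hD i)
    have hsum : ∑ i, dynOn G (dec ρ (v i)) (B i) ≤ ∑ i, (D ∩ B i).ncard :=
      Finset.sum_le_sum fun i _ => hle i
    by_cases hu : u ∈ D
    · rw [if_pos hu]
      split_ifs <;> omega
    · rw [if_neg hu]
      split_ifs with hδ
      · omega
      by_contra hcon
      have heq : ∑ i, dynOn G (dec ρ (v i)) (B i) = ∑ i, (D ∩ B i).ncard := by omega
      have heqi : ∀ i, dynOn G (dec ρ (v i)) (B i) = (D ∩ B i).ncard := fun i =>
        (Finset.sum_eq_sum_iff_of_le fun i _ => hle i).1 heq i (Finset.mem_univ i)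
      apply hδ
      choose H hH1 hH2 hH3 hH4 using fun i =>
        exists_hull G ρ (Set.inter_subset_right : D ∩ B i ⊆ B i)
      have hHA : (⋃ i, H i) ⊆ A := Set.iUnion_subset fun i => (hH2 i).trans (S.sub i)
      have huH : u ∉ ⋃ i, H i := by
        intro h
        obtain ⟨i, hi⟩ := Set.mem_iUnion.1 h
        exact S.uB i (hH2 i hi)
      have hDH : D ⊆ ⋃ i, H i := by
        intro w hw
        rcases S.cover w (hD.1 hw) with rfl | ⟨i, hi⟩
        · exact absurd hw hu
        · exact Set.mem_iUnion.2 ⟨i, hH1 i ⟨hw, hi⟩⟩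
      have hmem : ∀ i, ∀ w ∈ B i, w ∈ (⋃ j, H j) → w ∈ H i := by
        intro i w hw h
        obtain ⟨j, hj⟩ := Set.mem_iUnion.1 h
        have := S.disj j i w (hH2 j hj) hw
        exact this ▸ hj
      by_contra hlt
      apply huH
      apply hD.2 _ hDH hHA _ S.uA
      intro w hw hcnt
      rcases S.cover w hw with rfl | ⟨i, hi⟩
      · exfalso
        apply hlt
        rw [S.count hHA] at hcnt
        refine hcnt.trans (Int.ofNat_le.2 (Finset.card_le_card ?_))
        intro i hi
        simp only [Finset.mem_filter, Finset.mem_univ, true_and] at hi ⊢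
        have hvi := hmem i _ (S.vB i) hi
        apply le_antisymm _ (dyn_mono (dec_le ρ _))
        rw [heqi]
        apply dyn_le_s5
        refine ⟨Set.inter_subset_right, fun K h1 h2 h3 => ?_⟩
        refine Set.Subset.trans ?_ (hH4 i K h1 h2 h3)
        refine (S.restrict hD i).2 (H i) (hH1 i) (hH2 i) ?_
        intro x hx hxc
        by_cases hxv : x = v i
        · exact hxv ▸ hvi
        · apply hH3 i x hx
          simpa [dec, hxv] using hxc
      · refine Set.mem_iUnion.2 ⟨i, hH3 i w hi (hcnt.trans ?_)⟩
        refine Int.ofNat_le.2 (Set.ncard_le_ncard ?_)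
        rintro x ⟨hx1, hx2⟩
        refine ⟨?_, hx2⟩
        rcases S.adjB i w hi x (hHA hx1) hx2 with h | h
        · exact hmem i x h hx1
        · exact absurd (h.1 ▸ hx1) huH

theorem Split.setSum_eq (S : Split G A u v B) (f : V → ℤ) :
    setSum A f = f u + ∑ i, setSum (B i) f := by
  unfold setSum
  rw [Finset.sum_comm]
  have h1 : f u = ∑ w, if w = u then f u else 0 := by simp
  rw [h1, ← Finset.sum_add_distrib]
  refine Finset.sum_congr rfl fun w _ => ?_
  by_cases hwu : w = u
  · subst hwu
    rw [if_pos rfl, Set.indicator_of_mem S.uA, Finset.sum_eq_zero, add_zero]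
    intro i _
    exact Set.indicator_of_notMem (S.uB i) _
  · rw [if_neg hwu, zero_add]
    by_cases hwA : w ∈ A
    · rw [Set.indicator_of_mem hwA]
      rcases S.cover w hwA with h | ⟨i, hi⟩
      · exact absurd h hwu
      · rw [Finset.sum_eq_single i, Set.indicator_of_mem hi]
        · intro j _ hj
          exact Set.indicator_of_notMem (fun h => hj (S.disj j i w h hi)) _
        · simp
    · rw [Set.indicator_of_notMem hwA, Finset.sum_eq_zero]
      intro i _
      exact Set.indicator_of_notMem (fun h => hwA (S.sub i h)) _

theorem setSum_le {s : Set V} {f g : V → ℤ} (h : ∀ w ∈ s, f w ≤ g w) :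
    setSum s f ≤ setSum s g := by
  unfold setSum
  refine Finset.sum_le_sum fun w _ => ?_
  by_cases hw : w ∈ s
  · simpa [hw] using h w hw
  · simp [hw]

theorem setSum_nonneg {s : Set V} {f : V → ℤ} (h : ∀ w ∈ s, 0 ≤ f w) : 0 ≤ setSum s f := by
  have := setSum_le (f := fun _ => 0) h
  simpa [setSum] using this

theorem setSum_congr {s : Set V} {f g : V → ℤ} (h : ∀ w ∈ s, f w = g w) :
    setSum s f = setSum s g :=
  le_antisymm (setSum_le fun w hw => (h w hw).le) (setSum_le fun w hw => (h w hw).ge)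

end Dyn

theorem xval_bdd {V : Type*} [Fintype V] [DecidableEq V] (T : SimpleGraph V) (r : V)
    (τ ιmax : V → ℤ) (j : ℤ) (u : V) (b : ℤ) :
    BddAbove {n | ∃ ι : V → ℤ, (∀ v ∈ descSet T r u, 0 ≤ ι v ∧ ι v ≤ ιmax v) ∧
    setSum (descSet T r u) ι = b ∧
    n = dynOn T (fun v => τ v + ι v - if v = u then j else 0) (descSet T r u)} := by
  refine ⟨Fintype.card V, ?_⟩
  rintro n ⟨ι, _, _, rfl⟩
  exact dyn_le_card _ _

/-- the decomposition formula, specialised to the thresholds in `xval` -/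
theorem dyn_formula {V : Type*} [Fintype V] [DecidableEq V] {T : SimpleGraph V} {A : Set V}
    {u : V} {k : ℕ} {v : Fin k → V} {B : Fin k → Set V} (S : Split T A u v B)
    (τ ι : V → ℤ) (j : ℤ) :
    dynOn T (fun w => τ w + ι w - if w = u then j else 0) A =
      (if τ u + ι u - j ≤ ((Finset.univ.filter fun i : Fin k =>
        dynOn T (fun w => τ w + ι w) (B i) =
        dynOn T (fun w => τ w + ι w - if w = v i then 1 else 0) (B i)).card : ℤ) then 0 else 1) +
      ∑ i, dynOn T (fun w => τ w + ι w - if w = v i then 1 else 0) (B i) := by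
  have h0 : ∀ i, dynOn T (fun w => τ w + ι w - if w = u then j else 0) (B i) =
      dynOn T (fun w => τ w + ι w) (B i) := fun i => dyn_congr fun w hw => by
    have : w ≠ u := fun h => S.uB i (h ▸ hw)
    simp [this]
  have h1 : ∀ i, dynOn T (dec (fun w => τ w + ι w - if w = u then j else 0) (v i)) (B i) =
      dynOn T (fun w => τ w + ι w - if w = v i then 1 else 0) (B i) :=
    fun i => dyn_congr fun w hw => by
      have : w ≠ u := fun h => S.uB i (h ▸ hw)
      simp [this, dec]
  rw [S.dyn_eq]
  simp only [h0, h1, if_true]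

/-- Lemma 2: if `u` has children `v 0, …, v (k-1)` (`k ≥ 1`) and for every child `v i`
and every admissible budget `b_i` a single increment attains `x₀(v i, b_i)` and
`x₁(v i, b_i)` simultaneously, then `x_j(u,b) = z_j(u,b)` for `j ∈ {0,1}`. -/
theorem xval_eq_zval {V : Type*} [Fintype V] [DecidableEq V] (T : SimpleGraph V)
    (hT : T.IsTree) (r : V) (τ ιmax : V → ℤ) (hι : ∀ w, 0 ≤ ιmax w)
    (u : V) (k : ℕ) (hk : 1 ≤ k) (v : Fin k → V) (hinj : Function.Injective v)
    (hchild : ∀ w : V, (T.Adj u w ∧ w ∈ descSet T r u) ↔ ∃ i, v i = w)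
    (b : ℤ) (hb0 : 0 ≤ b) (hb : b ≤ setSum (descSet T r u) ιmax)
    (hcommon : ∀ i : Fin k, ∀ bi : ℤ, 0 ≤ bi → bi ≤ setSum (descSet T r (v i)) ιmax →
      ∃ ι : V → ℤ, (∀ w ∈ descSet T r (v i), 0 ≤ ι w ∧ ι w ≤ ιmax w) ∧
        setSum (descSet T r (v i)) ι = bi ∧
        dynOn T (fun w => τ w + ι w) (descSet T r (v i)) = xval T r τ ιmax 0 (v i) bi ∧
        dynOn T (fun w => τ w + ι w - if w = v i then 1 else 0) (descSet T r (v i)) =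
          xval T r τ ιmax 1 (v i) bi) :
    ∀ j ∈ ({0, 1} : Set ℤ),
      xval T r τ ιmax j u b = zval T r τ ιmax j u v b := by
  intro j _
  have S := split_desc hT r u k v hinj hchild
  set A := descSet T r u with hA
  have hx0 : ∀ i bi, xval T r τ ιmax 0 (v i) bi = sSup {n | ∃ ι : V → ℤ,
      (∀ w ∈ descSet T r (v i), 0 ≤ ι w ∧ ι w ≤ ιmax w) ∧
      setSum (descSet T r (v i)) ι = bi ∧
      n = dynOn T (fun w => τ w + ι w - if w = v i then 0 else 0) (descSet T r (v i))} :=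
    fun i bi => rfl
  have hsub : {n | ∃ (bu : ℤ) (bs : Fin k → ℤ), 0 ≤ bu ∧ (∀ i, 0 ≤ bs i) ∧
    bu + ∑ i, bs i = b ∧ bu ≤ ιmax u ∧
    (∀ i, bs i ≤ setSum (descSet T r (v i)) ιmax) ∧
    n = (if τ u + bu - j ≤ ((Finset.univ.filter fun i : Fin k =>
          xval T r τ ιmax 0 (v i) (bs i) = xval T r τ ιmax 1 (v i) (bs i)).card : ℤ)
        then 0 else 1) + ∑ i, xval T r τ ιmax 1 (v i) (bs i)} ⊆
    {n | ∃ ι : V → ℤ, (∀ v ∈ descSet T r u, 0 ≤ ι v ∧ ι v ≤ ιmax v) ∧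
    setSum (descSet T r u) ι = b ∧
    n = dynOn T (fun v => τ v + ι v - if v = u then j else 0) (descSet T r u)} := by
    rintro n ⟨bu, bs, hbu, hbs, hsum, hbu', hbs', rfl⟩
    choose ι hι1 hι2 hι3 hι4 using fun i => hcommon i (bs i) (hbs i) (hbs' i)
    let κ : V → ℤ := fun w => if w = u then bu else
      if h : ∃ i, w ∈ descSet T r (v i) then ι h.choose w else 0
    have hκu : κ u = bu := if_pos rfl
    have hκ : ∀ i, ∀ w ∈ descSet T r (v i), κ w = ι i w := by
      intro i w hw
      have hne : w ≠ u := fun h => S.uB i (h ▸ hw)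
      have hex : ∃ i, w ∈ descSet T r (v i) := ⟨i, hw⟩
      have hi : hex.choose = i := S.disj _ _ w hex.choose_spec hw
      simp only [κ, if_neg hne, dif_pos hex, hi]
    refine ⟨κ, ?_, ?_, ?_⟩
    · intro w hw
      rcases S.cover w hw with rfl | ⟨i, hi⟩
      · rw [hκu]
        exact ⟨hbu, hbu'⟩
      · rw [hκ i w hi]
        exact hι1 i w hi
    · rw [S.setSum_eq, hκu, ← hsum]
      congr 1
      refine Finset.sum_congr rfl fun i _ => ?_
      rw [setSum_congr (hκ i), hι2]
    · rw [dyn_formula S]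
      have e0 : ∀ i, dynOn T (fun w => τ w + κ w) (descSet T r (v i)) =
          xval T r τ ιmax 0 (v i) (bs i) := fun i => by
        rw [← hι3 i]
        exact dyn_congr fun w hw => by rw [hκ i w hw]
      have e1 : ∀ i, dynOn T (fun w => τ w + κ w - if w = v i then 1 else 0) (descSet T r (v i)) =
          xval T r τ ιmax 1 (v i) (bs i) := fun i => by
        rw [← hι4 i]
        exact dyn_congr fun w hw => by rw [hκ i w hw]
      simp only [e0, e1, hκu]
  have hbX := xval_bdd T r τ ιmax j u b
  have hbZ := hbX.mono hsub
  apply le_antisymm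
  · refine csSup_le' ?_
    rintro n ⟨ι, h1, h2, rfl⟩
    have hBi : ∀ i, ∀ w ∈ descSet T r (v i), 0 ≤ ι w ∧ ι w ≤ ιmax w :=
      fun i w hw => h1 w (S.sub i hw)
    let bs : Fin k → ℤ := fun i => setSum (descSet T r (v i)) ι
    have d0 : ∀ i, dynOn T (fun w => τ w + ι w) (descSet T r (v i)) ≤
        xval T r τ ιmax 0 (v i) (bs i) := fun i =>
      le_csSup (xval_bdd T r τ ιmax 0 (v i) (bs i)) ⟨ι, hBi i, rfl, by simp⟩
    have d1 : ∀ i, dynOn T (fun w => τ w + ι w - if w = v i then 1 else 0) (descSet T r (v i)) ≤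
        xval T r τ ιmax 1 (v i) (bs i) := fun i =>
      le_csSup (xval_bdd T r τ ιmax 1 (v i) (bs i)) ⟨ι, hBi i, rfl, rfl⟩
    have d01 : ∀ i, dynOn T (fun w => τ w + ι w - if w = v i then 1 else 0) (descSet T r (v i)) ≤
        dynOn T (fun w => τ w + ι w) (descSet T r (v i)) := fun i =>
      dyn_mono fun w => by split_ifs <;> omega
    have hmem := le_csSup hbZ ⟨ι u, bs, (h1 u S.uA).1, fun i => setSum_nonneg fun w hw => (hBi i w hw).1,
      by rw [← h2, S.setSum_eq], (h1 u S.uA).2, fun i => setSum_le fun w hw => (hBi i w hw).2, rfl⟩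
    refine le_trans ?_ hmem
    rw [dyn_formula S]
    have hs := Finset.sum_le_sum (s := Finset.univ) fun i _ => d1 i
    by_cases hall : ∀ i, dynOn T (fun w => τ w + ι w - if w = v i then 1 else 0)
        (descSet T r (v i)) = xval T r τ ιmax 1 (v i) (bs i)
    · refine add_le_add ?_ hs
      have hcard : (Finset.univ.filter fun i : Fin k =>
          xval T r τ ιmax 0 (v i) (bs i) = xval T r τ ιmax 1 (v i) (bs i)).card ≤
          (Finset.univ.filter fun i : Fin k =>
        dynOn T (fun w => τ w + ι w) (descSet T r (v i)) =
        dynOn T (fun w => τ w + ι w - if w = v i then 1 else 0) (descSet T r (v i))).card := by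
        apply Finset.card_le_card
        intro i hi
        simp only [Finset.mem_filter, Finset.mem_univ, true_and] at hi ⊢
        have := d0 i
        have := d01 i
        have := hall i
        omega
      split_ifs <;> omega
    · push Not at hall
      obtain ⟨i, hi⟩ := hall
      have hlt := Finset.sum_lt_sum (s := Finset.univ) (fun i _ => d1 i)
        ⟨i, Finset.mem_univ i, lt_of_le_of_ne (d1 i) hi⟩
      split_ifs <;> omega
  · exact csSup_le_csSup' hbX hsub
end

section
/- Let T be a finite tree rooted at a vertex r and let τ, ι_max : V(T) → ℤ with ι_max(v) ≥ 0 for every vertex v. Then for every vertex u of T and every integer b with 0 ≤ b ≤ Σ_{v∈V_u} ι_max(v), there exists a single function ι : V_u → ℤ with 0 ≤ ι(v) ≤ ι_max(v) for every v ∈ V_u and Σ_{v∈V_u} ι(v) = b such that simultaneously dyn(T_u, (τ+ι)|_{V_u}) = x_0(u,b) and dyn(T_u, ((τ+ι)^{→u})|_{V_u}) = x_1(u,b). -/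
open scoped BigOperators Classical

theorem aux_dyn_exists {V : Type*} [Fintype V] (G : SimpleGraph V) (ρ : V → ℤ) (A : Set V) :
    ∃ D : Set V, IsDynMonoOn G ρ A D ∧ D.ncard = dynOn G ρ A := by
  have : ({n | ∃ D : Set V, IsDynMonoOn G ρ A D ∧ D.ncard = n} : Set ℕ).Nonempty :=
    ⟨A.ncard, A, ⟨subset_rfl, fun H h _ _ => h⟩, rfl⟩
  exact Nat.sInf_mem this

theorem aux_dyn_le {V : Type*} [Fintype V] (G : SimpleGraph V) (ρ : V → ℤ) (A D : Set V)
    (h : IsDynMonoOn G ρ A D) : dynOn G ρ A ≤ D.ncard :=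
  Nat.sInf_le ⟨D, h, rfl⟩

theorem aux_dyn_mono {V : Type*} [Fintype V] (G : SimpleGraph V) (ρ σ : V → ℤ) (A : Set V)
    (hle : ∀ v, ρ v ≤ σ v) : dynOn G ρ A ≤ dynOn G σ A := by
  obtain ⟨D, ⟨h1, h2⟩, hc⟩ := aux_dyn_exists G σ A
  rw [← hc]
  refine aux_dyn_le G ρ A D ⟨h1, fun H a b c => h2 H a b fun v hv hh => c v hv ((hle v).trans hh)⟩

theorem aux_dyn_succ {V : Type*} [Fintype V] (G : SimpleGraph V) (ρ σ : V → ℤ) (A : Set V)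
    (u : V) (hu : u ∈ A) (heq : ∀ v, v ≠ u → ρ v = σ v) : dynOn G ρ A ≤ dynOn G σ A + 1 := by
  obtain ⟨D, ⟨h1, h2⟩, hc⟩ := aux_dyn_exists G σ A
  rw [← hc]
  refine (aux_dyn_le G ρ A (insert u D) ⟨Set.insert_subset hu h1, fun H a b c => ?_⟩).trans
    (Set.ncard_insert_le u D)
  refine h2 H ((Set.subset_insert u D).trans a) b fun v hv hh => ?_
  by_cases hvu : v = u
  · exact hvu ▸ a (Set.mem_insert u D)
  · exact c v hv (by rw [heq v hvu]; exact hh)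

theorem aux_fill {V : Type*} [Fintype V] [DecidableEq V] (A : Set V) (m : V → ℤ)
    (hm : ∀ v, 0 ≤ m v) (n : ℕ) : (n : ℤ) ≤ setSum A m →
    ∃ ι : V → ℤ, (∀ v ∈ A, 0 ≤ ι v ∧ ι v ≤ m v) ∧ setSum A ι = n := by
  induction n with
  | zero => exact fun _ => ⟨fun _ => 0, fun v _ => ⟨le_rfl, hm v⟩, by simp [setSum]⟩
  | succ n ih =>
    intro h
    push_cast at h
    obtain ⟨ι, h1, h2⟩ := ih (by omega)
    have hlt : setSum A ι < setSum A m := by omega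
    obtain ⟨v, -, hv⟩ := Finset.exists_lt_of_sum_lt hlt
    have hvA : v ∈ A := by
      by_contra hn
      simp [hn] at hv
    simp only [Set.indicator_of_mem hvA] at hv
    refine ⟨fun w => ι w + if w = v then 1 else 0, fun w hw => ?_, ?_⟩
    · have := h1 w hw
      by_cases hwv : w = v
      · subst hwv; simp; omega
      · simpa [hwv] using this
    · have key : ∀ w, A.indicator (fun w => ι w + if w = v then 1 else 0) w
          = A.indicator ι w + if w = v then 1 else 0 := by
        intro w
        by_cases hw : w ∈ A
        · simp [hw]
        · have : w ≠ v := fun e => hw (e ▸ hvA)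
          simp [hw, this]
      unfold setSum at h2 ⊢
      simp only [key, Finset.sum_add_distrib, h2]
      simp

theorem aux_xval {V : Type*} [Fintype V] [DecidableEq V] (T : SimpleGraph V) (r : V)
    (τ m : V → ℤ) (j : ℤ) (u : V) (b : ℤ) (hm : ∀ v, 0 ≤ m v) (hb : 0 ≤ b)
    (hb' : b ≤ setSum (descSet T r u) m) :
    (∃ ι : V → ℤ, (∀ v ∈ descSet T r u, 0 ≤ ι v ∧ ι v ≤ m v) ∧
      setSum (descSet T r u) ι = b ∧ xval T r τ m j u b =
        dynOn T (fun v => τ v + ι v - if v = u then j else 0) (descSet T r u)) ∧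
    ∀ ι : V → ℤ, (∀ v ∈ descSet T r u, 0 ≤ ι v ∧ ι v ≤ m v) →
      setSum (descSet T r u) ι = b →
        dynOn T (fun v => τ v + ι v - if v = u then j else 0) (descSet T r u)
          ≤ xval T r τ m j u b := by
  have hbdd : BddAbove {n | ∃ ι : V → ℤ, (∀ v ∈ descSet T r u, 0 ≤ ι v ∧ ι v ≤ m v) ∧
    setSum (descSet T r u) ι = b ∧
    n = dynOn T (fun v => τ v + ι v - if v = u then j else 0) (descSet T r u)} := by
    refine ⟨(descSet T r u).ncard, ?_⟩
    rintro n ⟨ι, -, -, rfl⟩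
    exact aux_dyn_le _ _ _ _ ⟨subset_rfl, fun H h _ _ => h⟩
  constructor
  · lift b to ℕ using hb
    obtain ⟨ι, h1, h2⟩ := aux_fill _ m hm b hb'
    have hne : {n | ∃ ι : V → ℤ, (∀ v ∈ descSet T r u, 0 ≤ ι v ∧ ι v ≤ m v) ∧
      setSum (descSet T r u) ι = b ∧
      n = dynOn T (fun v => τ v + ι v - if v = u then j else 0) (descSet T r u)}.Nonempty :=
      ⟨_, ι, h1, h2, rfl⟩
    exact Nat.sSup_mem hne hbdd
  · exact fun ι h1 h2 => le_csSup hbdd ⟨ι, h1, h2, rfl⟩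

/-- Corollary: for every vertex `u` and every `0 ≤ b ≤ ∑_{v ∈ V_u} ιmax v`, a single
increment `ι` attains both `x₀(u,b)` and `x₁(u,b)` simultaneously. -/
theorem exists_common_increment {V : Type*} [Fintype V] [DecidableEq V] (T : SimpleGraph V)
    (hT : T.IsTree) (r : V) (τ ιmax : V → ℤ) (hι : ∀ v, 0 ≤ ιmax v) :
    ∀ u : V, ∀ b : ℤ, 0 ≤ b → b ≤ setSum (descSet T r u) ιmax →
      ∃ ι : V → ℤ, (∀ v ∈ descSet T r u, 0 ≤ ι v ∧ ι v ≤ ιmax v) ∧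
        setSum (descSet T r u) ι = b ∧
        dynOn T (fun v => τ v + ι v) (descSet T r u) = xval T r τ ιmax 0 u b ∧
        dynOn T (fun v => τ v + ι v - if v = u then 1 else 0) (descSet T r u) =
          xval T r τ ιmax 1 u b := by
  
  intro u b hb hb'
  have hu : u ∈ descSet T r u := fun p _ => p.end_mem_support
  obtain ⟨⟨ι₀, a1, a2, a3⟩, a4⟩ := aux_xval T r τ ιmax 0 u b hι hb hb'
  obtain ⟨⟨ι₁, c1, c2, c3⟩, c4⟩ := aux_xval T r τ ιmax 1 u b hι hb hb'
  simp only [ite_self, sub_zero] at a3 a4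
  have lo : ∀ ι : V → ℤ, dynOn T (fun v => τ v + ι v - if v = u then 1 else 0) (descSet T r u)
      ≤ dynOn T (fun v => τ v + ι v) (descSet T r u) := fun ι =>
    aux_dyn_mono _ _ _ _ fun v => by split_ifs <;> omega
  have hi : ∀ ι : V → ℤ, dynOn T (fun v => τ v + ι v) (descSet T r u) ≤
      dynOn T (fun v => τ v + ι v - if v = u then 1 else 0) (descSet T r u) + 1 := fun ι =>
    aux_dyn_succ _ _ _ _ u hu fun v hv => by simp [hv]
  have e1 := lo ι₀
  have e2 := hi ι₀
  have e3 := lo ι₁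
  have e4 := hi ι₁
  have e5 := a4 ι₁ c1 c2
  have e6 := c4 ι₀ a1 a2
  by_cases h : xval T r τ ιmax 0 u b = xval T r τ ιmax 1 u b
  · exact ⟨ι₁, c1, c2, by omega, by omega⟩
  · exact ⟨ι₀, a1, a2, by omega, by omega⟩
end

section
/- Let G be a finite simple graph and let τ be a threshold function for G with 0 ≤ τ(u) ≤ d_G(u) + 1 for every vertex u. Then dyn(G, τ) ≤ Σ_{u∈V(G)} τ(u)/(d_G(u)+1). -/
open scoped BigOperators Classical

/-- truncated ratio -/
noncomputable def wgt (t : ℤ) (d : ℕ) : ℝ := min 1 ((t : ℝ) / ((d : ℝ) + 1))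

/-- degree of `u` into `A` -/
noncomputable def dIn {V : Type*} (G : SimpleGraph V) (A : Finset V) (u : V) : ℕ :=
  (A.filter (fun v => G.Adj u v)).card

/-- indicator that `u` must be put in the seed set, if it comes last in `A` -/
noncomputable def bad (t : ℤ) (d : ℕ) : ℝ := if (d : ℤ) < t then 1 else 0

lemma wgt_step (t : ℤ) (ht : 0 ≤ t) (d : ℕ) :
    (bad t d - wgt t d) + d * (wgt t (d - 1) - wgt t d) ≤ 0 := by
  unfold bad
  have hd : (0 : ℝ) < (d : ℝ) + 1 := by positivity
  split_ifs with h
  · have h' : (d : ℝ) + 1 ≤ t := by exact_mod_cast h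
    have h1 : wgt t d = 1 := by
      unfold wgt
      rw [min_eq_left]
      rwa [le_div_iff₀ hd, one_mul]
    have h2 : wgt t (d - 1) ≤ 1 := min_le_left _ _
    rw [h1]
    have : (0 : ℝ) ≤ d := by positivity
    nlinarith
  · push Not at h
    have h' : (t : ℝ) ≤ d := by exact_mod_cast h
    have h1 : wgt t d = t / ((d : ℝ) + 1) := by
      unfold wgt
      rw [min_eq_right]
      rw [div_le_one hd]; linarith
    have h3 : ((d : ℝ) + 1) * wgt t d = t := by
      rw [h1]; field_simp
    have h2 : (d : ℝ) * wgt t (d - 1) ≤ t := by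
      rcases d with _ | k
      · simp; exact_mod_cast ht
      · have : wgt t (k + 1 - 1) ≤ (t : ℝ) / ((k : ℝ) + 1) := min_le_right _ _
        have hk : (0 : ℝ) < (k : ℝ) + 1 := by positivity
        rw [le_div_iff₀ hk] at this
        rw [Nat.add_sub_cancel] at this ⊢
        push_cast
        linarith
    linarith

lemma dIn_erase {V : Type*} (G : SimpleGraph V) (A : Finset V) (u v : V) (hv : v ∈ A) :
    dIn G (A.erase v) u = if G.Adj u v then dIn G A u - 1 else dIn G A u := by
  unfold dIn
  rw [Finset.filter_erase]
  split_ifs with h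
  · rw [Finset.card_erase_of_mem]; simp [hv, h]
  · rw [Finset.erase_eq_of_notMem]; simp [h]

lemma exists_last {V : Type*} (G : SimpleGraph V) (τ : V → ℤ) (hτ : ∀ u, 0 ≤ τ u)
    (A : Finset V) (hA : A.Nonempty) :
    ∃ v ∈ A, bad (τ v) (dIn G A v) + ∑ u ∈ A.erase v, wgt (τ u) (dIn G (A.erase v) u)
      ≤ ∑ u ∈ A, wgt (τ u) (dIn G A u) := by
  apply Finset.exists_le_of_sum_le hA
  have key : ∀ v ∈ A, bad (τ v) (dIn G A v)
      + ∑ u ∈ A.erase v, wgt (τ u) (dIn G (A.erase v) u)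
      = ∑ u ∈ A, (wgt (τ u) (dIn G A u)
        + ((if u = v then bad (τ u) (dIn G A u) - wgt (τ u) (dIn G A u) else 0)
        + (if G.Adj u v then wgt (τ u) (dIn G A u - 1) - wgt (τ u) (dIn G A u) else 0))) := by
    intro v hv
    rw [← Finset.add_sum_erase A _ hv]
    congr 1
    · simp
    · apply Finset.sum_congr rfl
      intro u hu
      rw [dIn_erase G A u v hv, if_neg (Finset.ne_of_mem_erase hu)]
      split_ifs <;> ring
  rw [Finset.sum_congr rfl key, Finset.sum_comm, Finset.sum_comm (s := A) (t := A)
    (f := fun _ u => wgt (τ u) (dIn G A u))]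
  apply Finset.sum_le_sum
  intro u hu
  rw [Finset.sum_add_distrib, Finset.sum_add_distrib, Finset.sum_ite_eq, if_pos hu,
    ← Finset.sum_filter, Finset.sum_const, Finset.sum_const, nsmul_eq_mul, nsmul_eq_mul]
  have := wgt_step (τ u) (hτ u) (dIn G A u)
  change _ + (_ + ((dIn G A u : ℕ) : ℝ) * _) ≤ _
  linarith

lemma exists_seed {V : Type*} [Fintype V] (G : SimpleGraph V) (τ : V → ℤ) (hτ : ∀ u, 0 ≤ τ u)
    (n : ℕ) : ∀ A : Finset V, A.card = n → ∃ D : Finset V,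
      (D.card : ℝ) ≤ ∑ u ∈ A, wgt (τ u) (dIn G A u) ∧
      ∀ H : Set V, (D : Set V) ⊆ H → Closed G τ Set.univ H → (A : Set V) ⊆ H := by
  induction n with
  | zero =>
    intro A hA
    rw [Finset.card_eq_zero] at hA
    subst hA
    exact ⟨∅, by simp, by simp⟩
  | succ n ih =>
    intro A hA
    obtain ⟨v, hv, hle⟩ := exists_last G τ hτ A (Finset.card_pos.mp (by omega))
    obtain ⟨D, hD, hH⟩ := ih (A.erase v) (by rw [Finset.card_erase_of_mem hv]; omega)
    by_cases hb : (dIn G A v : ℤ) < τ v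
    · refine ⟨insert v D, ?_, ?_⟩
      · have h1 : ((insert v D).card : ℝ) ≤ D.card + 1 := by
          exact_mod_cast Finset.card_insert_le v D
        rw [bad, if_pos hb] at hle
        linarith
      · intro H hDH hc x hx
        by_cases hxv : x = v
        · subst hxv; exact hDH (by simp)
        · exact hH H (fun y hy => hDH (by simp at hy; simp [hy])) hc (by
            simp at hx; simp [hx, hxv])
    · refine ⟨D, ?_, ?_⟩
      · rw [bad, if_neg hb] at hle
        linarith
      · intro H hDH hc
        have h1 := hH H hDH hc
        intro x hx
        by_cases hxv : x = v
        · subst hxv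
          apply hc x trivial
          have h2 : dIn G A x ≤ (H ∩ G.neighborSet x).ncard := by
            unfold dIn
            rw [← Set.ncard_coe_finset]
            apply Set.ncard_le_ncard _ (Set.toFinite _)
            intro y hy
            simp at hy
            exact ⟨h1 (by simp [hy.1, hy.2.ne']), hy.2⟩
          push Not at hb
          have : (dIn G A x : ℤ) ≤ ((H ∩ G.neighborSet x).ncard : ℤ) := by exact_mod_cast h2
          linarith
        · exact h1 (by simp at hx; simp [hx, hxv])

/-- The bound of Ackerman, Ben-Zwi, and Wolfovitz:
`dyn(G,τ) ≤ ∑_u τ(u)/(d_G(u)+1)` whenever `0 ≤ τ(u) ≤ d_G(u)+1` for all `u`. -/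
theorem dyn_le_sum_ratio {V : Type*} [Fintype V] (G : SimpleGraph V)
    [DecidableRel G.Adj] (τ : V → ℤ)
    (hτ : ∀ u, 0 ≤ τ u ∧ τ u ≤ (G.degree u : ℤ) + 1) :
    (dyn G τ : ℝ) ≤ ∑ u, (τ u : ℝ) / ((G.degree u : ℝ) + 1) := by
  obtain ⟨D, hD, hH⟩ := exists_seed G τ (fun u => (hτ u).1) _ Finset.univ rfl
  have h1 : dyn G τ ≤ D.card := by
    apply Nat.sInf_le
    refine ⟨(D : Set V), ⟨Set.subset_univ _, fun H hDH _ hc => ?_⟩, Set.ncard_coe_finset D⟩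
    simpa using hH H hDH hc
  have h2 : (dyn G τ : ℝ) ≤ D.card := by exact_mod_cast h1
  refine (h2.trans hD).trans (Finset.sum_le_sum fun u _ => ?_)
  have h3 : dIn G Finset.univ u = G.degree u := by
    unfold dIn
    rw [← SimpleGraph.card_neighborFinset_eq_degree]
    congr 1
    ext y
    simp
  rw [h3]
  exact min_le_right _ _
end

section
/- Let G be a finite simple graph and let k be a positive integer. Then the vertex set of the k-core of G equals V(G) \ H_{(G, τ)}(∅), where τ is the threshold function with τ(u) = d_G(u) − k + 1 for every vertex u. Here the vertex set of the k-core is the unique maximal set S ⊆ V(G) such that every vertex of S has at least k neighbors in S. -/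
open scoped BigOperators Classical

/-- the hull of `D` in `(G,ρ)`: the smallest set `H ⊇ D` such that every vertex with at
least `ρ u` neighbors in `H` belongs to `H` -/
def hullSet {V : Type*} [Fintype V] (G : SimpleGraph V) (ρ : V → ℤ) (D : Set V) : Set V :=
  ⋂₀ {H : Set V | D ⊆ H ∧ ∀ u : V, ρ u ≤ ((H ∩ G.neighborSet u).ncard : ℤ) → u ∈ H}

/-- The vertex set of the `k`-core of `G` (the unique maximal set `S` such that every
vertex of `S` has at least `k` neighbors in `S`) equals
`V(G) \ H_{(G, d_G − k + 1)}(∅)`. -/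
theorem kCore_eq_compl_hull {V : Type*} [Fintype V] (G : SimpleGraph V)
    [DecidableRel G.Adj] (k : ℕ) (hk : 1 ≤ k) (S : Set V)
    (hS : ∀ w ∈ S, k ≤ (S ∩ G.neighborSet w).ncard)
    (hmax : ∀ S' : Set V, (∀ w ∈ S', k ≤ (S' ∩ G.neighborSet w).ncard) → S' ⊆ S) :
    S = Set.univ \ hullSet G (fun u => (G.degree u : ℤ) - (k : ℤ) + 1) ∅ := by
  have key : ∀ (H : Set V) (u : V),
      (H ∩ G.neighborSet u).ncard + (Hᶜ ∩ G.neighborSet u).ncard = G.degree u := by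
    intro H u
    have h1 := Set.ncard_inter_add_ncard_sdiff_eq_ncard (G.neighborSet u) H (Set.toFinite _)
    have h2 : (G.neighborSet u).ncard = G.degree u := by
      rw [Set.ncard_eq_toFinset_card', ← SimpleGraph.card_neighborFinset_eq_degree, SimpleGraph.neighborFinset]
    rw [← h2, ← h1, Set.inter_comm H, Set.inter_comm Hᶜ, Set.sdiff_eq]
  ext x
  simp only [Set.mem_sdiff, Set.mem_univ, true_and, hullSet, Set.mem_sInter, Set.mem_ofPred_eq]
  constructor
  · intro hx h
    refine h Sᶜ ⟨Set.empty_subset _, fun u hu huS => ?_⟩ hx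
    have h1 := key S u
    have h2 := hS u huS
    omega
  · intro h
    push Not at h
    obtain ⟨H, ⟨-, hH⟩, hx⟩ := h
    refine hmax Hᶜ (fun w hw => ?_) hx
    by_contra hlt
    apply hw
    apply hH
    have h1 := key H w
    omega
end

section
/- For every finite tree T of order n ≥ 1, Σ_{u∈V(T)} d_T(u)² ≤ n² − n, where d_T denotes the degree function of T. -/
open scoped BigOperators Classical

/-- For every tree `T` of order `n ≥ 1`, `∑_u d_T(u)² ≤ n² − n`. -/
theorem sum_degree_sq_le {V : Type*} [Fintype V] [DecidableEq V] (T : SimpleGraph V)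
    [DecidableRel T.Adj] (hT : T.IsTree) (hn : 1 ≤ Fintype.card V) :
    ∑ u, (T.degree u) ^ 2 ≤ (Fintype.card V) ^ 2 - Fintype.card V := by
  obtain ⟨m, hm⟩ : ∃ m, Fintype.card V = m + 1 := ⟨Fintype.card V - 1, by omega⟩
  have hE : ∑ u, T.degree u = 2 * m := by
    have h1 := T.sum_degrees_eq_twice_card_edges
    have h2 := hT.card_edgeFinset
    rw [h1]
    omega
  have key : ∀ u, T.degree u ^ 2 + m ≤ (m + 1) * T.degree u := by
    intro u
    have hlt := T.degree_lt_card_verts u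
    rw [hm] at hlt
    rcases Nat.eq_zero_or_pos m with h0 | hpos
    · have : T.degree u = 0 := by omega
      simp [this, h0]
    · have : Nontrivial V := Fintype.one_lt_card_iff_nontrivial.mp (by omega)
      have hd : 0 < T.degree u := hT.connected.preconnected.degree_pos_of_nontrivial u
      obtain ⟨a, ha⟩ : ∃ a, T.degree u = a + 1 := ⟨T.degree u - 1, by omega⟩
      rw [ha] at hlt ⊢
      obtain ⟨b, rfl⟩ : ∃ b, m = a + 1 + b := ⟨m - (a + 1), by omega⟩
      nlinarith [Nat.zero_le (a * b)]
  have hs := Finset.sum_le_sum (fun u (_ : u ∈ Finset.univ) => key u)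
  rw [Finset.sum_add_distrib, ← Finset.mul_sum, hE] at hs
  simp only [Finset.sum_const, Finset.card_univ, smul_eq_mul, hm] at hs
  rw [hm]
  apply Nat.le_sub_of_add_le
  nlinarith
end

section
/- Let T be a finite tree with m(T) edges and let b be an integer with 0 ≤ b ≤ 2·m(T). Then there exists a matching M of T such that vacc(T, 0, d_T, b) = dyn(T, τ_M) and Σ_{u∈V(T)} τ_M(u) ≤ b. -/
open scoped BigOperators Classical

lemma kz_root {V : Type*} (T : SimpleGraph V) (hT : T.IsTree) :
    ∃ (r : V) (p : V → V) (h : V → ℕ), (∀ u, u ≠ r → h (p u) < h u) ∧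
      (∀ u v, T.Adj u v ↔ (u ≠ r ∧ p u = v) ∨ (v ≠ r ∧ p v = u)) := by
  obtain ⟨r⟩ := hT.connected.nonempty
  choose f hf hf' using (hT.existsUnique_path · r)
  have key : ∀ u, u ≠ r → T.Adj u (f u).snd ∧ (f (f u).snd).length < (f u).length := by
    intro u hu
    have hn : ¬ (f u).Nil := SimpleGraph.Walk.not_nil_of_ne hu
    refine ⟨(f u).adj_snd hn, ?_⟩
    have h1 := hf' _ (f u).tail (hf u).tail
    have h2 := SimpleGraph.Walk.length_tail_add_one hn
    rw [← h1]
    omega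
  refine ⟨r, fun u => (f u).snd, fun u => (f u).length, fun u hu => (key u hu).2, ?_⟩
  intro u v
  constructor
  · intro huv
    by_cases hv : v ∈ (f u).support
    · left
      refine ⟨?_, (hT.isAcyclic.eq_snd_of_adj_start (hf u) huv hv).symm⟩
      rintro rfl
      have : f u = SimpleGraph.Walk.nil := (hf' u _ SimpleGraph.Walk.IsPath.nil).symm
      rw [this] at hv
      simp at hv
      exact huv.ne hv.symm
    · right
      refine ⟨?_, ?_⟩
      · rintro rfl
        exact hv (f u).end_mem_support
      · have := hf' v (SimpleGraph.Walk.cons huv.symm (f u)) ((SimpleGraph.Walk.cons_isPath_iff _ _).2 ⟨hf u, hv⟩)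
        show (f v).snd = u
        rw [← this]
        simp
  · rintro (⟨hu, rfl⟩ | ⟨hv, rfl⟩)
    · exact (key u hu).1
    · exact (key v hv).1.symm

lemma kz_rec {V : Type*} [Fintype V] (h : V → ℕ) (C : V → Finset V)
    (hC : ∀ v, ∀ c ∈ C v, h v < h c) (ρ : V → ℤ) :
    (∃ R : V → ℤ, ∀ v, R v = ρ v - (((C v).filter (fun c => R c ≠ 1)).card : ℤ)) ∧
    (∀ P : V → Prop, (∀ v, (∀ c ∈ C v, P c) → P v) → ∀ v, P v) := by
  have wf : WellFounded (fun c v : V => h v < h c) := by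
    have : IsTrans V (fun c v : V => h v < h c) := ⟨fun a b c h1 h2 => lt_trans h2 h1⟩
    have : Std.Irrefl (fun c v : V => h v < h c) := ⟨fun a => lt_irrefl _⟩
    exact Finite.wellFounded_of_trans_of_irrefl _
  constructor
  · let F : (v : V) → ((c : V) → h v < h c → ℤ) → ℤ := fun v g =>
      ρ v - (((C v).filter (fun c => ∃ hc : h v < h c, g c hc ≠ 1)).card : ℤ)
    refine ⟨wf.fix F, fun v => ?_⟩
    rw [wf.fix_eq]
    show ρ v - (((C v).filter (fun c => ∃ hc : h v < h c, wf.fix F c ≠ 1)).card : ℤ) = _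
    congr 3
    apply Finset.filter_congr
    intro c hc
    simp [hC v c hc]
  · intro P hP v
    exact wf.induction v (fun v ih => hP v (fun c hc => ih c (hC v c hc)))

lemma kz_main {V : Type*} [Fintype V] [DecidableEq V]
    (T : SimpleGraph V) [DecidableRel T.Adj] (hT : T.IsTree) (ρ : V → ℤ)
    (h0 : ∀ u, 0 ≤ ρ u) (hd : ∀ u, ρ u ≤ T.degree u) :
    ∃ (D : Finset V) (e : V → V), IsDynMonoOn T ρ Set.univ (D : Set V) ∧
      (∀ v ∈ D, T.Adj v (e v) ∧ e v ∉ D) ∧ Set.InjOn e (D : Set V) ∧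
      (∑ v ∈ D, ((T.degree v : ℤ) + T.degree (e v))) ≤ ∑ u, ρ u := by
  obtain ⟨r, p, h, hp, hadj⟩ := kz_root T hT
  let C : V → Finset V := fun v => Finset.univ.filter (fun c => c ≠ r ∧ p c = v)
  have hmC : ∀ v c, c ∈ C v ↔ c ≠ r ∧ p c = v := by intro v c; simp [C]
  have hC : ∀ v, ∀ c ∈ C v, h v < h c := by
    intro v c hc
    obtain ⟨h1, rfl⟩ := (hmC _ _).1 hc
    exact hp c h1
  obtain ⟨⟨R, hR⟩, hind⟩ := kz_rec h C hC ρ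
  let S : Finset V := Finset.univ.filter (fun v => v ≠ r ∧ R v = 1)
  let D : Finset V := Finset.univ.filter (fun v => 2 ≤ R v ∨ (v = r ∧ 1 ≤ R v))
  have hmS : ∀ v, v ∈ S ↔ v ≠ r ∧ R v = 1 := by intro v; simp [S]
  have hmD : ∀ v, v ∈ D ↔ 2 ≤ R v ∨ (v = r ∧ 1 ≤ R v) := by intro v; simp [D]
  have hdegr : T.degree r = (C r).card := by
    rw [← SimpleGraph.card_neighborFinset_eq_degree]
    congr 1
    ext c
    simp [hmC, hadj]
  have hpn : ∀ v, v ≠ r → p v ∉ C v := by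
    intro v hv hc
    have := hC _ _ hc
    have := hp v hv
    omega
  have hdeg : ∀ v, v ≠ r → T.degree v = (C v).card + 1 := by
    intro v hv
    rw [← SimpleGraph.card_neighborFinset_eq_degree, ← Finset.card_insert_of_notMem (hpn v hv)]
    congr 1
    ext c
    simp only [SimpleGraph.mem_neighborFinset, hadj, Finset.mem_insert, hmC]
    constructor
    · rintro (⟨_, h⟩ | h)
      · exact Or.inl h.symm
      · exact Or.inr h
    · rintro (h | h)
      · exact Or.inl ⟨hv, h.symm⟩
      · exact Or.inr h
  let c1 : V → ℕ := fun v => ((C v).filter (fun c => R c = 1)).card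
  have hsplit : ∀ v, (c1 v : ℤ) + (((C v).filter (fun c => R c ≠ 1)).card : ℤ) = (C v).card := by
    intro v
    exact_mod_cast Finset.card_filter_add_card_filter_not (s := C v) (fun c => R c = 1)
  have hρS : ∀ v ∈ S, ρ v = T.degree v - c1 v := by
    intro v hv
    obtain ⟨h1, h2⟩ := (hmS v).1 hv
    have := hR v
    have := hsplit v
    have := hdeg v h1
    push_cast [this]
    omega
  have hρD : ∀ v ∈ D, (T.degree v : ℤ) + 1 - c1 v ≤ ρ v := by
    intro v hv
    have h3 := hR v
    have h4 := hsplit v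
    by_cases hvr : v = r
    · have h5 : T.degree v = (C v).card := by rw [hvr]; exact hdegr
      have h6 : 1 ≤ R v := by
        rcases (hmD v).1 hv with h | h
        · omega
        · exact h.2
      rw [h5]
      omega
    · have h5 := hdeg v hvr
      have h6 : 2 ≤ R v := by
        rcases (hmD v).1 hv with h | h
        · omega
        · exact absurd h.1 hvr
      rw [h5]
      push_cast
      omega
  have hex : ∀ v, ∃ c, v ∈ D → c ∈ C v ∧ R c = 1 := by
    intro v
    by_cases hv : v ∈ D
    · have h1 := hρD v hv
      have h2 := hd v
      have h3 : 0 < c1 v := by omega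
      obtain ⟨c, hc⟩ := Finset.card_pos.1 h3
      exact ⟨c, fun _ => by simpa using hc⟩
    · exact ⟨v, fun h => absurd h hv⟩
  choose e he using hex
  have heS : ∀ v ∈ D, e v ∈ S := by
    intro v hv
    exact (hmS _).2 ⟨((hmC _ _).1 (he v hv).1).1, (he v hv).2⟩
  have hdisj : Disjoint S D := by
    rw [Finset.disjoint_left]
    intro v h1 h2
    obtain ⟨h3, h4⟩ := (hmS v).1 h1
    rcases (hmD v).1 h2 with h | h
    · omega
    · exact h3 h.1
  have hinj : Set.InjOn e (D : Set V) := by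
    intro a ha b hb hab
    have h1 := ((hmC _ _).1 (he a ha).1).2
    have h2 := ((hmC _ _).1 (he b hb).1).2
    rw [← h1, ← h2, hab]
  refine ⟨D, e, ⟨Set.subset_univ _, ?_⟩, ?_, hinj, ?_⟩
  · intro H hDH _ hcl
    have hcount : ∀ (u : V) (X : Finset V), (∀ x ∈ X, x ∈ H ∧ T.Adj u x) → ρ u ≤ X.card → u ∈ H := by
      intro u X hX hle
      apply hcl u (Set.mem_univ u)
      refine hle.trans ?_
      rw [← Set.ncard_coe_finset]
      exact_mod_cast Set.ncard_le_ncard (fun x hx => hX x hx) (Set.toFinite _)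
    have hCadj : ∀ v, ∀ c ∈ C v, T.Adj v c := by
      intro v c hc
      exact (hadj v c).2 (Or.inr ((hmC _ _).1 hc))
    have hA : ∀ v, v ∉ S → v ∈ H := by
      apply hind
      intro v ih hvS
      by_cases hvD : v ∈ D
      · exact hDH hvD
      · have h1 : R v ≤ 0 := by
          by_contra hcon
          by_cases hvr : v = r
          · exact hvD ((hmD v).2 (Or.inr ⟨hvr, by omega⟩))
          · by_cases h2 : R v = 1
            · exact hvS ((hmS v).2 ⟨hvr, h2⟩)
            · exact hvD ((hmD v).2 (Or.inl (by omega)))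
        apply hcount v ((C v).filter (fun c => R c ≠ 1))
        · intro x hx
          rw [Finset.mem_filter] at hx
          exact ⟨ih x hx.1 (fun hxS => hx.2 ((hmS x).1 hxS).2), hCadj v x hx.1⟩
        · have := hR v
          omega
    have hB : ∀ n, ∀ v, h v = n → v ∈ H := by
      intro n
      induction n using Nat.strong_induction_on with
      | _ n ih =>
        intro v hv
        by_cases hvS : v ∈ S
        · obtain ⟨h1, h2⟩ := (hmS v).1 hvS
          have hnm : p v ∉ (C v).filter (fun c => R c ≠ 1) := fun hx =>
            hpn v h1 (Finset.mem_filter.1 hx).1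
          apply hcount v (insert (p v) ((C v).filter (fun c => R c ≠ 1)))
          · intro x hx
            rw [Finset.mem_insert] at hx
            rcases hx with rfl | hx
            · exact ⟨ih _ (hv ▸ hp v h1) _ rfl, (hadj _ _).2 (Or.inl ⟨h1, rfl⟩)⟩
            · rw [Finset.mem_filter] at hx
              exact ⟨hA x (fun hxS => hx.2 ((hmS x).1 hxS).2), hCadj v x hx.1⟩
          · rw [Finset.card_insert_of_notMem hnm]
            have := hR v
            push_cast
            omega
        · exact hA v hvS
    intro v _
    exact hB _ v rfl
  · intro v hv
    exact ⟨(hadj _ _).2 (Or.inr ((hmC _ _).1 (he v hv).1)),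
      fun h => Finset.disjoint_left.1 hdisj (heS v hv) h⟩
  · have hc1 : ∑ v ∈ S ∪ D, c1 v ≤ S.card := by
      have h1 : ∀ v, c1 v = (S.filter (fun c => p c = v)).card := by
        intro v
        show ((C v).filter (fun c => R c = 1)).card = _
        congr 1
        ext c
        simp only [Finset.mem_filter, hmC, hmS]
        tauto
      calc ∑ v ∈ S ∪ D, c1 v ≤ ∑ v, c1 v :=
            Finset.sum_le_sum_of_subset (Finset.subset_univ _)
        _ = ∑ v, (S.filter (fun c => p c = v)).card := Finset.sum_congr rfl (fun v _ => h1 v)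
        _ = S.card := (Finset.card_eq_sum_card_fiberwise (fun _ _ => Finset.mem_coe.2 (Finset.mem_univ _))).symm
    rw [Finset.sum_union hdisj] at hc1
    have hsub : D.image e ⊆ S := by
      intro x hx
      obtain ⟨v, hv, rfl⟩ := Finset.mem_image.1 hx
      exact heS v hv
    have hsumS : ∑ v ∈ S, ((T.degree v : ℤ) - 1) ≥ ∑ v ∈ D, ((T.degree (e v) : ℤ) - 1) := by
      rw [← Finset.sum_image (f := fun x => ((T.degree x : ℤ) - 1)) hinj]
      apply Finset.sum_le_sum_of_subset_of_nonneg hsub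
      intro v hv _
      have := hdeg v ((hmS v).1 hv).1
      rw [this]
      push_cast
      omega
    have hρ : ∑ v ∈ S, ρ v + ∑ v ∈ D, ρ v ≤ ∑ v, ρ v := by
      rw [← Finset.sum_union hdisj]
      exact Finset.sum_le_sum_of_subset_of_nonneg (Finset.subset_univ _) (fun v _ _ => h0 v)
    have e1 : ∑ v ∈ S, ρ v = ∑ v ∈ S, ((T.degree v : ℤ) - c1 v) := Finset.sum_congr rfl hρS
    have e2 : ∑ v ∈ D, ((T.degree v : ℤ) + 1 - c1 v) ≤ ∑ v ∈ D, ρ v := Finset.sum_le_sum hρD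
    have hc1' : (∑ v ∈ S, (c1 v : ℤ)) + ∑ v ∈ D, (c1 v : ℤ) ≤ S.card := by exact_mod_cast hc1
    simp only [Finset.sum_sub_distrib, Finset.sum_add_distrib, Finset.sum_const, nsmul_eq_mul,
      mul_one] at *
    linarith

lemma kz_dyn {V : Type*} [Fintype V] [DecidableEq V]
    (T : SimpleGraph V) [DecidableRel T.Adj] (hT : T.IsTree) (D : Finset V) (e : V → V)
    (he : ∀ v ∈ D, T.Adj v (e v) ∧ e v ∉ D) (hinj : Set.InjOn e (D : Set V)) :
    dyn T (tauM T {x | ∃ v ∈ D, x = s(v, e v)}) = D.card := by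
  set M : Set (Sym2 V) := {x | ∃ v ∈ D, x = s(v, e v)} with hM
  have hcov : ∀ u, (∃ x ∈ M, u ∈ x) ↔ ∃ v ∈ D, u = v ∨ u = e v := by
    intro u
    constructor
    · rintro ⟨x, ⟨v, hv, rfl⟩, hu⟩
      exact ⟨v, hv, by simpa using hu⟩
    · rintro ⟨v, hv, hu⟩
      exact ⟨s(v, e v), ⟨v, hv, rfl⟩, by simpa using hu⟩
  have hdegn : ∀ u, (T.neighborSet u).ncard = T.degree u := by
    intro u
    rw [← SimpleGraph.card_neighborFinset_eq_degree, ← Set.ncard_coe_finset]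
    simp
  have hlow : ∀ X : Set V, IsDynMonoOn T (tauM T M) Set.univ X → D.card ≤ X.ncard := by
    intro X hX
    have hone : ∀ v ∈ D, v ∈ X ∨ e v ∈ X := by
      intro v hv
      by_contra hcon
      push Not at hcon
      have := hX.2 ({v, e v}ᶜ) (by
        intro x hx
        simp only [Set.mem_compl_iff, Set.mem_insert_iff, Set.mem_singleton_iff, not_or]
        exact ⟨fun h => hcon.1 (h ▸ hx), fun h => hcon.2 (h ▸ hx)⟩) (Set.subset_univ _) (by
        have main : ∀ u w, (∃ v ∈ D, u = v ∨ u = e v) → T.Adj u w → w ∈ ({v, e v} : Set V) →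
            ¬ (tauM T M u ≤ ((({v, e v} : Set V)ᶜ ∩ T.neighborSet u).ncard : ℤ)) := by
          intro u w hu huw hw hle
          rw [tauM, if_pos ((hcov u).2 hu), ← hdegn] at hle
          have : ((({v, e v} : Set V)ᶜ ∩ T.neighborSet u)).ncard < (T.neighborSet u).ncard := by
            apply Set.ncard_lt_ncard _ (Set.toFinite _)
            refine ⟨Set.inter_subset_right, fun hs => ?_⟩
            exact (hs (show w ∈ T.neighborSet u from huw)).1 hw
          omega
        intro u _ hle
        simp only [Set.mem_compl_iff, Set.mem_insert_iff, Set.mem_singleton_iff]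
        rintro (rfl | rfl)
        · exact main u (e u) ⟨u, hv, Or.inl rfl⟩ (he u hv).1 (by simp) hle
        · exact main (e v) v ⟨v, hv, Or.inr rfl⟩ (he v hv).1.symm (by simp) hle)
      exact this (Set.mem_univ v) (by simp)
    let g : V → V := fun v => if v ∈ X then v else e v
    rw [← Set.ncard_coe_finset]
    refine Set.ncard_le_ncard_of_injOn g ?_ ?_ (Set.toFinite _)
    · intro v hv
      by_cases h : v ∈ X
      · simp [g, h]
      · simp only [g, h, if_false]
        exact (hone v hv).resolve_left h
    · intro a ha b hb hab
      have ha' := (he a ha).2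
      have hb' := (he b hb).2
      simp only [g] at hab
      split_ifs at hab
      · exact hab
      · exact absurd (hab ▸ ha) hb'
      · exact absurd (hab ▸ hb) ha'
      · exact hinj ha hb hab
  have hup : ∃ X : Set V, IsDynMonoOn T (tauM T M) Set.univ X ∧ X.ncard ≤ D.card := by
    have c := hT.coloringTwo
    refine ⟨((D.image (fun v => if c v = 0 then v else e v) : Finset V) : Set V), ⟨Set.subset_univ _, ?_⟩, ?_⟩
    · intro H hXH _ hcl
      have hzero : ∀ u, c u = 0 → u ∈ H := by
        intro u hu
        by_cases hc : ∃ v ∈ D, u = v ∨ u = e v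
        · apply hXH
          obtain ⟨v, hv, hvu⟩ := hc
          simp only [Finset.coe_image, Set.mem_image]
          refine ⟨v, hv, ?_⟩
          rcases hvu with rfl | rfl
          · simp [hu]
          · have := c.valid (he v hv).1
            rw [hu] at this
            simp [this]
        · apply hcl u (Set.mem_univ u)
          rw [tauM, if_neg (fun h => hc ((hcov u).1 h))]
          positivity
      intro u _
      by_cases hu : c u = 0
      · exact hzero u hu
      · have hsub : T.neighborSet u ⊆ H := by
          intro w hw
          apply hzero
          have := c.valid hw
          omega
        apply hcl u (Set.mem_univ u)
        rw [Set.inter_eq_right.2 hsub, hdegn, tauM]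
        split_ifs <;> simp
    · rw [Set.ncard_coe_finset]
      exact Finset.card_image_le
  obtain ⟨X, hX, hXc⟩ := hup
  have hXc' : X.ncard = D.card := le_antisymm hXc (hlow X hX)
  apply le_antisymm
  · exact Nat.sInf_le ⟨X, hX, hXc'⟩
  · refine le_csInf (s := {n | ∃ D : Set V, IsDynMonoOn T (tauM T M) Set.univ D ∧ D.ncard = n})
      ⟨_, X, hX, hXc'⟩ ?_
    rintro n ⟨Y, hY, rfl⟩
    exact hlow Y hY

lemma kz_sum {ι : Type*} (s : Finset ι) (f : ι → ℤ) (hf : ∀ i ∈ s, 0 ≤ f i) (b : ℤ)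
    (hb0 : 0 ≤ b) (hb : b ≤ ∑ i ∈ s, f i) :
    ∃ g : ι → ℤ, (∀ i ∈ s, 0 ≤ g i ∧ g i ≤ f i) ∧ ∑ i ∈ s, g i = b := by
  induction s using Finset.induction_on generalizing b with
  | empty => exact ⟨0, by simp, by simp at hb ⊢; omega⟩
  | insert a s ha ih =>
    rw [Finset.sum_insert ha] at hb
    have hfa := hf a (Finset.mem_insert_self a s)
    have hns : 0 ≤ ∑ i ∈ s, f i := Finset.sum_nonneg (fun i hi => hf i (Finset.mem_insert_of_mem hi))
    obtain ⟨g, hg, hgs⟩ := ih (fun i hi => hf i (Finset.mem_insert_of_mem hi)) (b - min b (f a))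
      (by omega) (by omega)
    refine ⟨Function.update g a (min b (f a)), ?_, ?_⟩
    · intro i hi
      by_cases hia : i = a
      · subst hia
        simp [hb0, hfa]
      · rw [Function.update_of_ne hia]
        exact hg i ((Finset.mem_insert.1 hi).resolve_left hia)
    · rw [Finset.sum_insert ha, Function.update_self, Finset.sum_congr rfl (g := g), hgs]
      · omega
      · intro i hi
        have hia : i ≠ a := fun h => ha (h ▸ hi)
        rw [Function.update_of_ne hia]

/-- Theorem (Khoshkhah–Zaker): for a tree `T` and `0 ≤ b ≤ 2m(T)`, there is a matching
`M` of `T` with `vacc(T,0,d_T,b) = dyn(T,τ_M)` and `∑_u τ_M(u) ≤ b`. -/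
theorem khoshkhah_zaker_tree {V : Type*} [Fintype V] [DecidableEq V]
    (T : SimpleGraph V) [DecidableRel T.Adj] (hT : T.IsTree)
    (b : ℤ) (hb0 : 0 ≤ b) (hb : b ≤ 2 * (T.edgeFinset.card : ℤ)) :
    ∃ M : Set (Sym2 V), MatchingSet T M ∧
      vacc T 0 (fun u => (T.degree u : ℤ)) b = dyn T (tauM T M) ∧
      (∑ u, tauM T M u) ≤ b := by
  have hne : {n | ∃ ι : V → ℤ, (∀ u, 0 ≤ ι u ∧ ι u ≤ (T.degree u : ℤ)) ∧ (∑ u, ι u) = b ∧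
      n = dyn T (fun v => (0 : V → ℤ) v + ι v)}.Nonempty := by
    obtain ⟨g, hg, hgs⟩ := kz_sum Finset.univ (fun u => (T.degree u : ℤ)) (by simp) b hb0 (by
      refine hb.trans ?_
      have := T.sum_degrees_eq_twice_card_edges
      have h2 : (∑ u, (T.degree u : ℤ)) = 2 * (T.edgeFinset.card : ℤ) := by exact_mod_cast this
      rw [h2])
    exact ⟨_, g, fun u => hg u (Finset.mem_univ u), hgs, rfl⟩
  have hle : ∀ (ρ : V → ℤ) (X : Set V), IsDynMonoOn T ρ Set.univ X → dyn T ρ ≤ X.ncard :=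
    fun ρ X hX => Nat.sInf_le ⟨X, hX, rfl⟩
  have hbdd : BddAbove {n | ∃ ι : V → ℤ, (∀ u, 0 ≤ ι u ∧ ι u ≤ (T.degree u : ℤ)) ∧
      (∑ u, ι u) = b ∧ n = dyn T (fun v => (0 : V → ℤ) v + ι v)} := by
    refine ⟨(Set.univ : Set V).ncard, ?_⟩
    rintro n ⟨ι, _, _, rfl⟩
    exact hle _ _ ⟨subset_rfl, fun H h _ _ => h⟩
  obtain ⟨ι, hι, hsum, hv⟩ := Nat.sSup_mem hne hbdd
  change vacc T 0 (fun u => (T.degree u : ℤ)) b = _ at hv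
  have hz : (fun v => (0 : V → ℤ) v + ι v) = ι := by ext; simp
  rw [hz] at hv
  obtain ⟨D, e, hD, he, hinj, hs⟩ := kz_main T hT ι (fun u => (hι u).1) (fun u => (hι u).2)
  have hcard : dyn T ι ≤ D.card := by
    have := hle _ _ hD
    rwa [Set.ncard_coe_finset] at this
  obtain ⟨D', hD', hD'c⟩ := Finset.exists_subset_card_eq hcard
  have he' : ∀ v ∈ D', T.Adj v (e v) ∧ e v ∉ D' :=
    fun v hv => ⟨(he v (hD' hv)).1, fun h => (he v (hD' hv)).2 (hD' h)⟩
  have hinj' : Set.InjOn e (D' : Set V) := hinj.mono (by exact_mod_cast hD')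
  refine ⟨{x | ∃ v ∈ D', x = s(v, e v)}, ⟨?_, ?_⟩, ?_, ?_⟩
  · rintro x ⟨v, hv, rfl⟩
    exact (he' v hv).1
  · rintro x ⟨v, hv, rfl⟩ y ⟨w, hw, rfl⟩ hxy u hu hu'
    apply hxy
    have h1 := (he' v hv).2
    have h2 := (he' w hw).2
    simp only [Sym2.mem_iff] at hu hu'
    have : v = w := by
      rcases hu with rfl | rfl <;> rcases hu' with h | h
      · exact h
      · exact absurd (h ▸ hv) h2
      · exact absurd (h ▸ hw) h1
      · exact hinj' hv hw h
    rw [this]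
  · rw [kz_dyn T hT D' e he' hinj', hD'c, hv]
  · have hdis : Disjoint D' (D'.image e) := by
      rw [Finset.disjoint_right]
      intro x hx
      obtain ⟨v, hv, rfl⟩ := Finset.mem_image.1 hx
      exact (he' v hv).2
    have hstep : (∑ u, tauM T {x | ∃ v ∈ D', x = s(v, e v)} u)
        ≤ ∑ u ∈ D' ∪ D'.image e, (T.degree u : ℤ) := by
      rw [← Finset.sum_subset (Finset.subset_univ (D' ∪ D'.image e))]
      · apply Finset.sum_le_sum
        intro u _
        rw [tauM]
        split_ifs <;> simp
      · intro u _ hu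
        rw [tauM, if_neg]
        rintro ⟨x, ⟨v, hv, rfl⟩, hux⟩
        apply hu
        rw [Finset.mem_union, Finset.mem_image]
        rcases Sym2.mem_iff.1 hux with rfl | rfl
        · exact Or.inl hv
        · exact Or.inr ⟨v, hv, rfl⟩
    rw [Finset.sum_union hdis, Finset.sum_image hinj', ← Finset.sum_add_distrib] at hstep
    have hmono : ∑ v ∈ D', ((T.degree v : ℤ) + T.degree (e v)) ≤
        ∑ v ∈ D, ((T.degree v : ℤ) + T.degree (e v)) :=
      Finset.sum_le_sum_of_subset_of_nonneg hD' (fun v _ _ => by positivity)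
    linarith
end
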